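/- arXiv:1701.09148 — 2 statements merged into one kernel-verified Lean document; each statement's English description precedes it below -/
import Mathlib

section
/- Let k = k(r) ≥ 2 and n = n(r) = k(r)·r be sequences with λ = k − 1 and k = o(n^{1−α}) for some fixed 0 < α < 1. Fix a real ε (positive or negative, small) and define H_{n,ε}(x) = log(λ·x·k^{x−1}·(Γ(r)/Γ(r − x + 1))·(Γ(n − x)/Γ(n))·exp((2 + ε)·√x)). Then for each sufficiently large r there is a unique point x_* maximizing H_{n,ε} on the interval [1, r], and both H_{n,ε}(x_*) and H_{n,ε}(⌊x_*⌋) equal (1 + ε/2)^{4/3}·(3/2)·(n/λ)^{1/3}·(1 + o(1)) as r → ∞. -/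
open Filter Finset Asymptotics MeasureTheory

noncomputable section

open scoped Classical

/-- `f` is a `{0,k}`-mapping: every point has either `0` or `k` preimages. -/
def IsZKMap {n : ℕ} (k : ℕ) (f : Fin n → Fin n) : Prop :=
  ∀ y : Fin n,
    (Finset.univ.filter fun x => f x = y).card = 0 ∨
    (Finset.univ.filter fun x => f x = y).card = k

/-- The finite set of `{0,k}`-mappings on `[n]`. -/
def zkMaps (n k : ℕ) : Finset (Fin n → Fin n) :=
  Finset.univ.filter fun f => IsZKMap k f

/-- The set of cyclic nodes of `f`. -/
def cyclicSet {n : ℕ} (f : Fin n → Fin n) : Finset (Fin n) :=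
  Finset.univ.filter fun x => ∃ m, 0 < m ∧ f^[m] x = x

/-- `Z f`: the number of cyclic nodes of `f`. -/
def Zmap {n : ℕ} (f : Fin n → Fin n) : ℕ := (cyclicSet f).card

/-- The cycles of `f`: the orbits of the cyclic nodes under `f`. -/
def cyclesOf {n : ℕ} (f : Fin n → Fin n) : Finset (Finset (Fin n)) :=
  (cyclicSet f).image fun x => (cyclicSet f).filter fun y => ∃ m, f^[m] x = y

/-- `T f`: the least common multiple of the cycle lengths of `f`. -/
def Tmap {n : ℕ} (f : Fin n → Fin n) : ℕ := (cyclesOf f).lcm Finset.card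

/-- `B f`: the product of the cycle lengths of `f`, counted with multiplicity. -/
def Bmap {n : ℕ} (f : Fin n → Fin n) : ℕ := ∏ c ∈ cyclesOf f, c.card

/-- `C f`: the number of cycles of `f`. -/
def Cmap {n : ℕ} (f : Fin n → Fin n) : ℕ := (cyclesOf f).card

/-- Uniform probability of the event `p` over `{0,k}`-mappings on `[n]`. -/
def zkProb (n k : ℕ) (p : (Fin n → Fin n) → Prop) : ℝ :=
  (((zkMaps n k).filter p).card : ℝ) / ((zkMaps n k).card : ℝ)

/-- Expectation of `X` under the uniform measure on `{0,k}`-mappings on `[n]`. -/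
def zkExp (n k : ℕ) (X : (Fin n → Fin n) → ℝ) : ℝ :=
  (∑ f ∈ zkMaps n k, X f) / ((zkMaps n k).card : ℝ)

/-- The standard normal cumulative distribution function. -/
def stdNormalCDF (x : ℝ) : ℝ :=
  (Real.sqrt (2 * Real.pi))⁻¹ * ∫ t in Set.Iic x, Real.exp (-t ^ 2 / 2)

/-- `M m`: the average order of a uniformly random permutation of `[m]`. -/
def Mperm (m : ℕ) : ℝ :=
  (∑ σ : Equiv.Perm (Fin m), (orderOf σ : ℝ)) / (m.factorial : ℝ)

theorem Real.log_Gamma_add_nat {a : ℝ} (ha : 0 < a) (M : ℕ) :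
    Real.log (Real.Gamma (a + M)) =
      Real.log (Real.Gamma a) + ∑ j ∈ Finset.range M, Real.log (a + j) := by
  induction M with
  | zero => simp
  | succ M ih =>
    have h : 0 < a + M := by positivity
    rw [Finset.sum_range_succ, ← add_assoc, ← ih, Nat.cast_succ, ← add_assoc,
      Real.Gamma_add_one h.ne', Real.log_mul h.ne' (Real.Gamma_pos_of_pos h).ne', add_comm]

theorem Real.log_sub_log_le_sum_inv {a : ℝ} (ha : 0 < a) (M : ℕ) :
    Real.log (a + M) - Real.log a ≤ ∑ j ∈ Finset.range M, 1 / (a + j) := by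
  induction M with
  | zero => simp
  | succ M ih =>
    have h : 0 < a + M := by positivity
    have h1 : 0 < a + M + 1 := by positivity
    rw [Finset.sum_range_succ, Nat.cast_succ, ← add_assoc]
    have := Real.log_le_sub_one_of_pos (div_pos h1 h)
    rw [Real.log_div h1.ne' h.ne'] at this
    have e : (a + M + 1) / (a + M) - 1 = 1 / (a + M) := by field_simp; ring
    linarith

theorem Real.sum_inv_le_log_sub_log {a : ℝ} (ha : 0 < a) (M : ℕ) :
    ∑ j ∈ Finset.range M, 1 / (a + 1 + j) ≤ Real.log (a + M) - Real.log a := by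
  induction M with
  | zero => simp
  | succ M ih =>
    have h : 0 < a + M := by positivity
    have h1 : 0 < a + M + 1 := by positivity
    rw [Finset.sum_range_succ, Nat.cast_succ, ← add_assoc]
    have := Real.log_le_sub_one_of_pos (div_pos h h1)
    rw [Real.log_div h.ne' h1.ne'] at this
    have e : (a + M) / (a + M + 1) - 1 = - (1 / (a + 1 + M)) := by
      have : 0 < a + 1 + M := by positivity
      field_simp; ring
    linarith

theorem inv_sub_inv_le_sum_inv_sq {a : ℝ} (ha : 0 < a) (M : ℕ) :
    1 / a - 1 / (a + M) ≤ ∑ j ∈ Finset.range M, 1 / (a + j) ^ 2 := by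
  induction M with
  | zero => simp
  | succ M ih =>
    have h : 0 < a + M := by positivity
    rw [Finset.sum_range_succ, Nat.cast_succ, ← add_assoc]
    have : 1 / (a + M) - 1 / (a + M + 1) ≤ 1 / (a + M) ^ 2 := by
      rw [div_sub_div _ _ (by positivity) (by positivity), div_le_div_iff₀ (by positivity) (by positivity)]
      nlinarith
    linarith

theorem sum_inv_sq_le_inv_sub_inv {a : ℝ} (ha : 0 < a) (M : ℕ) :
    ∑ j ∈ Finset.range M, 1 / (a + 1 + j) ^ 2 ≤ 1 / a - 1 / (a + M) := by
  induction M with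
  | zero => simp
  | succ M ih =>
    have h : 0 < a + M := by positivity
    rw [Finset.sum_range_succ, Nat.cast_succ, ← add_assoc]
    have : 1 / (a + 1 + M) ^ 2 ≤ 1 / (a + M) - 1 / (a + M + 1) := by
      rw [div_sub_div _ _ (by positivity) (by positivity), div_le_div_iff₀ (by positivity) (by positivity)]
      nlinarith
    linarith

theorem Real.log_one_sub_le {u : ℝ} (h0 : 0 ≤ u) (h1 : u < 1) :
    Real.log (1 - u) ≤ -u - u ^ 2 / 2 := by
  have h := Real.hasSum_pow_div_log_of_abs_lt_one (abs_lt.2 ⟨by linarith, h1⟩)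
  have := sum_le_hasSum (Finset.range 2) (fun i _ => by positivity) h
  norm_num [Finset.sum_range_succ] at this
  linarith

theorem Real.le_log_one_sub {u : ℝ} (h0 : 0 ≤ u) (h1 : u ≤ 1 / 2) :
    -u - u ^ 2 / 2 - 2 * u ^ 3 ≤ Real.log (1 - u) := by
  have h := Real.abs_log_sub_add_sum_range_le (abs_lt.2 ⟨by linarith, by linarith⟩ : |u| < 1) 2
  norm_num [Finset.sum_range_succ, abs_of_nonneg h0] at h
  have h2 : u ^ 3 / (1 - u) ≤ 2 * u ^ 3 := by
    rw [div_le_iff₀ (by linarith)]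
    nlinarith [pow_nonneg h0 3]
  have := (abs_le.1 (h.trans h2)).1
  linarith

theorem sum_log_one_sub_div_le {r x : ℝ} (hr : 0 < r) (hx : 0 ≤ x) (hxr : x ≤ r) (M : ℕ) :
    ∑ j ∈ Finset.range M, Real.log (1 - x / (r + 1 + j)) ≤
      -x * (Real.log (r + 1 + M) - Real.log r) - x ^ 2 / 2 * (1 / r - 1 / (r + 1 + M)) + 3 / 2 := by
  have h1 : ∑ j ∈ Finset.range M, Real.log (1 - x / (r + 1 + j)) ≤
      -x * ∑ j ∈ Finset.range M, 1 / (r + 1 + j) -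
        x ^ 2 / 2 * ∑ j ∈ Finset.range M, 1 / (r + 1 + j) ^ 2 := by
    rw [Finset.mul_sum, Finset.mul_sum, ← Finset.sum_sub_distrib]
    refine Finset.sum_le_sum fun j _ => ?_
    have hj : 0 < r + 1 + j := by positivity
    have := Real.log_one_sub_le (u := x / (r + 1 + j)) (by positivity)
      ((div_lt_one hj).2 (by have : (0 : ℝ) ≤ j := by positivity
                             linarith))
    refine this.trans (le_of_eq ?_)
    field_simp
  have h2 := mul_le_mul_of_nonneg_left
    (Real.log_sub_log_le_sum_inv (by positivity : 0 < r + 1) M) hx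
  have h3 := mul_le_mul_of_nonneg_left
    (inv_sub_inv_le_sum_inv_sq (by positivity : 0 < r + 1) M) (by positivity : 0 ≤ x ^ 2 / 2)
  have h4 : x * (Real.log (r + 1) - Real.log r) ≤ 1 := by
    have := Real.log_le_sub_one_of_pos (by positivity : 0 < (r + 1) / r)
    rw [Real.log_div (by positivity) hr.ne'] at this
    refine (mul_le_mul_of_nonneg_left this hx).trans ?_
    have e : x * ((r + 1) / r - 1) = x / r := by field_simp; ring
    rw [e]
    exact (div_le_one hr).2 hxr
  have h5 : x ^ 2 / 2 * (1 / r - 1 / (r + 1)) ≤ 1 / 2 := by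
    have e : x ^ 2 / 2 * (1 / r - 1 / (r + 1)) = x ^ 2 / (2 * (r * (r + 1))) := by
      field_simp; ring
    rw [e, div_le_div_iff₀ (by positivity) (by positivity)]
    nlinarith
  linarith

theorem le_sum_log_one_sub_div {r x : ℝ} (hr : 0 < r) (hx : 0 ≤ x) (hxr : x ≤ r / 2) (M : ℕ) :
    -x * (Real.log (r + 1 + M) - Real.log r) - x ^ 2 / 2 * (1 / r - 1 / (r + 1 + M))
        - 2 * x ^ 3 / r ^ 2 ≤
      ∑ j ∈ Finset.range M, Real.log (1 - x / (r + 1 + j)) := by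
  have h1 : -x * ∑ j ∈ Finset.range M, 1 / (r + 1 + j) -
        (x ^ 2 / 2 + 2 * x ^ 3 / r) * ∑ j ∈ Finset.range M, 1 / (r + 1 + j) ^ 2 ≤
      ∑ j ∈ Finset.range M, Real.log (1 - x / (r + 1 + j)) := by
    rw [Finset.mul_sum, Finset.mul_sum, ← Finset.sum_sub_distrib]
    refine Finset.sum_le_sum fun j _ => ?_
    have hj : 0 < r + 1 + j := by positivity
    have hj' : r ≤ r + 1 + j := by
      have : (0 : ℝ) ≤ j := by positivity
      linarith
    refine le_trans ?_ (Real.le_log_one_sub (u := x / (r + 1 + j)) (by positivity)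
      ((div_le_iff₀ hj).2 (by linarith)))
    have : 2 * (x / (r + 1 + j)) ^ 3 ≤ 2 * x ^ 3 / r * (1 / (r + 1 + j) ^ 2) := by
      rw [div_pow, div_mul_div_comm, ← mul_div_assoc, mul_one, pow_succ (r + 1 + (j : ℝ)) 2,
        mul_comm r]
      gcongr
    have e : x ^ 2 / 2 * (1 / (r + 1 + j) ^ 2) = (x / (r + 1 + j)) ^ 2 / 2 := by
      field_simp
    have e' : -x * (1 / (r + 1 + j)) = -(x / (r + 1 + j)) := by field_simp
    rw [add_mul, e, e']
    linarith
  have hle : r + M ≤ r + 1 + M := by linarith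
  have h2 : x * ∑ j ∈ Finset.range M, 1 / (r + 1 + j) ≤
      x * (Real.log (r + 1 + M) - Real.log r) := by
    refine mul_le_mul_of_nonneg_left ((Real.sum_inv_le_log_sub_log hr M).trans ?_) hx
    gcongr
  have h3 : ∑ j ∈ Finset.range M, 1 / (r + 1 + j) ^ 2 ≤ 1 / r - 1 / (r + 1 + M) := by
    refine (sum_inv_sq_le_inv_sub_inv hr M).trans ?_
    gcongr
  have h4 := mul_le_mul_of_nonneg_left h3 (by positivity : 0 ≤ x ^ 2 / 2)
  have h5 : 2 * x ^ 3 / r * ∑ j ∈ Finset.range M, 1 / (r + 1 + j) ^ 2 ≤ 2 * x ^ 3 / r ^ 2 := by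
    have : ∑ j ∈ Finset.range M, 1 / (r + 1 + j) ^ 2 ≤ 1 / r :=
      h3.trans (sub_le_self _ (by positivity))
    refine (mul_le_mul_of_nonneg_left this (by positivity)).trans (le_of_eq ?_)
    field_simp
  linarith

theorem concaveOn_log_one_sub_div {r a : ℝ} (hr : 0 ≤ r) (ha : r < a) :
    ConcaveOn ℝ (Set.Icc 1 r) fun x => Real.log (1 - x / a) := by
  refine ⟨convex_Icc _ _, fun x hx y hy p q hp hq hpq => ?_⟩
  have ha0 : 0 < a := hr.trans_lt ha
  have hpos : ∀ z ∈ Set.Icc 1 r, 1 - z / a ∈ Set.Ioi (0 : ℝ) := fun z hz =>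
    sub_pos.2 ((div_lt_one ha0).2 (hz.2.trans_lt ha))
  have := strictConcaveOn_log_Ioi.concaveOn.2 (hpos x hx) (hpos y hy) hp hq hpq
  refine this.trans (le_of_eq ?_)
  congr 1
  simp only [smul_eq_mul]
  linear_combination hpq

/-- The logarithm of the weight, with the Gamma quotients expanded into a finite product. -/
def logWeight (k r M : ℕ) (c x : ℝ) : ℝ :=
  Real.log ((k : ℝ) - 1) + Real.log x + (x - 1) * Real.log k - Real.log r +
    ∑ j ∈ Finset.range M, Real.log (1 - x / (r + 1 + j)) + 2 * c * Real.sqrt x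

theorem log_eq_logWeight {k r M : ℕ} (hk : 2 ≤ k) (hr : 1 ≤ r) (hM : r + 1 + M = k * r)
    (ε : ℝ) {x : ℝ} (hx : x ∈ Set.Icc (1 : ℝ) r) :
    Real.log (((k : ℝ) - 1) * x * (k : ℝ) ^ (x - 1) *
        (Real.Gamma (r : ℝ) / Real.Gamma ((r : ℝ) - x + 1)) *
        (Real.Gamma (((k * r : ℕ) : ℝ) - x) / Real.Gamma ((k * r : ℕ) : ℝ)) *
        Real.exp ((2 + ε) * Real.sqrt x)) = logWeight k r M (1 + ε / 2) x := by
  have hk' : (2 : ℝ) ≤ k := by exact_mod_cast hk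
  have hr' : (1 : ℝ) ≤ r := by exact_mod_cast hr
  have hM' : (0 : ℝ) ≤ M := by positivity
  obtain ⟨hx1, hxr⟩ := hx
  have hn : ((k * r : ℕ) : ℝ) = (r + 1 : ℝ) + M := by rw [← hM]; push_cast; ring
  have hnx : ((k * r : ℕ) : ℝ) - x = (r - x + 1 : ℝ) + M := by rw [hn]; ring
  rw [hnx, hn]
  have g1 : 0 < Real.Gamma r := Real.Gamma_pos_of_pos (by linarith)
  have g2 : 0 < Real.Gamma (r - x + 1) := Real.Gamma_pos_of_pos (by linarith)
  have g3 : 0 < Real.Gamma (r - x + 1 + M) := Real.Gamma_pos_of_pos (by linarith)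
  have g4 : 0 < Real.Gamma (r + 1 + M) := Real.Gamma_pos_of_pos (by linarith)
  have hk1 : (0 : ℝ) < k - 1 := by linarith
  have hx0 : 0 < x := by linarith
  have hkx : (0 : ℝ) < (k : ℝ) ^ (x - 1) := Real.rpow_pos_of_pos (by linarith) _
  rw [Real.log_mul (by positivity) (by positivity), Real.log_mul (by positivity) (by positivity),
    Real.log_mul (by positivity) (by positivity), Real.log_mul (by positivity) (by positivity),
    Real.log_mul (by positivity) (by positivity), Real.log_exp, Real.log_div g1.ne' g2.ne',
    Real.log_div g3.ne' g4.ne', Real.log_rpow (by linarith),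
    Real.log_Gamma_add_nat (by linarith : (0 : ℝ) < r - x + 1),
    Real.log_Gamma_add_nat (by linarith : (0 : ℝ) < r + 1),
    Real.Gamma_add_one (by linarith : (r : ℝ) ≠ 0), Real.log_mul (by linarith) g1.ne']
  have hs : ∑ j ∈ Finset.range M, Real.log (1 - x / (r + 1 + j)) =
      ∑ j ∈ Finset.range M, Real.log (r - x + 1 + j) -
        ∑ j ∈ Finset.range M, Real.log ((r : ℝ) + 1 + j) := by
    rw [← Finset.sum_sub_distrib]
    refine Finset.sum_congr rfl fun j _ => ?_
    have hj : (0 : ℝ) ≤ j := by positivity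
    rw [← Real.log_div (by linarith) (by linarith)]
    congr 1
    field_simp
    ring
  rw [logWeight, hs]
  ring

theorem strictConcaveOn_logWeight (k r M : ℕ) {c : ℝ} (hc : 0 ≤ c) :
    StrictConcaveOn ℝ (Set.Icc (1 : ℝ) r) (logWeight k r M c) := by
  have hsub : Set.Icc (1 : ℝ) r ⊆ Set.Ioi 0 := fun x hx => lt_of_lt_of_le one_pos hx.1
  have hconv : Convex ℝ (Set.Icc (1 : ℝ) r) := convex_Icc _ _
  have hsum : ∀ m : ℕ, ConcaveOn ℝ (Set.Icc (1 : ℝ) r)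
      fun x => ∑ j ∈ Finset.range m, Real.log (1 - x / (r + 1 + j)) := by
    intro m
    induction m with
    | zero => simpa using concaveOn_const (0 : ℝ) hconv
    | succ m ih =>
      simp only [Finset.sum_range_succ]
      refine ih.add (concaveOn_log_one_sub_div (by positivity) ?_)
      have : (0 : ℝ) ≤ m := by positivity
      linarith
  have hlin : ConcaveOn ℝ (Set.Icc (1 : ℝ) r)
      fun x => Real.log ((k : ℝ) - 1) - Real.log k - Real.log r + x * Real.log k := by
    refine ⟨hconv, fun x _ y _ p q _ _ hpq => le_of_eq ?_⟩
    simp only [smul_eq_mul]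
    linear_combination (Real.log ((k : ℝ) - 1) - Real.log k - Real.log r) * hpq
  have hsqrt : ConcaveOn ℝ (Set.Icc (1 : ℝ) r) fun x => (2 * c) • Real.sqrt x :=
    (Real.strictConcaveOn_sqrt.concaveOn.subset (fun x hx => zero_le_one.trans hx.1) hconv).smul
      (by positivity)
  have h := (strictConcaveOn_log_Ioi.subset hsub hconv).add_concaveOn
    ((hlin.add (hsum M)).add hsqrt)
  refine h.congr fun x _ => ?_
  simp only [logWeight, Pi.add_apply, smul_eq_mul]
  ring

theorem continuousOn_logWeight (k r M : ℕ) (c : ℝ) :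
    ContinuousOn (logWeight k r M c) (Set.Icc (1 : ℝ) r) := by
  unfold logWeight
  have h1 : ContinuousOn Real.log (Set.Icc (1 : ℝ) r) :=
    Real.continuousOn_log.mono fun x hx => (lt_of_lt_of_le one_pos hx.1).ne'
  have h2 : ContinuousOn (fun x : ℝ => ∑ j ∈ Finset.range M, Real.log (1 - x / (r + 1 + j)))
      (Set.Icc (1 : ℝ) r) := by
    refine continuousOn_finsetSum _ fun j _ => ContinuousOn.log (by fun_prop) fun x hx => ?_
    have hj : (0 : ℝ) ≤ j := by positivity
    have : (0 : ℝ) < r + 1 + j := by positivity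
    exact (sub_pos.2 ((div_lt_one this).2 (by linarith [hx.2]))).ne'
  fun_prop

theorem two_mul_sub_le {c s N t : ℝ} (hs : 0 < s) (hsN : s ^ 3 = c * N)
    (hc : 0 < c) (ht : 0 ≤ t) :
    2 * c * t - t ^ 4 / (2 * N) ≤ 3 / 2 * c * s := by
  have e : N = s ^ 3 / c := by field_simp; linarith
  rw [e]
  have : 2 * c * t - t ^ 4 / (2 * (s ^ 3 / c)) = c * (4 * t * s ^ 3 - t ^ 4) / (2 * s ^ 3) := by
    field_simp
    ring
  rw [this, div_le_iff₀ (by positivity)]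
  have h : 4 * t * s ^ 3 - t ^ 4 ≤ 3 * s ^ 4 := by
    nlinarith [mul_nonneg (sq_nonneg (s - t))
      (by positivity : 0 ≤ t ^ 2 + 2 * t * s + 3 * s ^ 2)]
  nlinarith

theorem log_add_cast_sub_log {k r M : ℕ} (hk : 2 ≤ k) (hr : 1 ≤ r) (hM : r + 1 + M = k * r) :
    Real.log ((r : ℝ) + 1 + M) - Real.log r = Real.log k := by
  have hM' : (r : ℝ) + 1 + M = k * r := by exact_mod_cast hM
  rw [hM', Real.log_mul (by positivity) (by positivity)]
  ring

theorem inv_sub_inv_cast {k r M : ℕ} (hk : 2 ≤ k) (hr : 1 ≤ r) (hM : r + 1 + M = k * r) :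
    1 / (r : ℝ) - 1 / (r + 1 + M) = 1 / ((k * r : ℕ) / ((k : ℝ) - 1)) := by
  have hM' : (r : ℝ) + 1 + M = k * r := by exact_mod_cast hM
  have hk' : (2 : ℝ) ≤ k := by exact_mod_cast hk
  have : (0 : ℝ) < k - 1 := by linarith
  rw [hM']
  push_cast
  field_simp

theorem logWeight_le {k r M : ℕ} (hk : 2 ≤ k) (hr : 1 ≤ r) (hM : r + 1 + M = k * r)
    (c : ℝ) {x : ℝ} (hx : x ∈ Set.Icc (1 : ℝ) r) :
    logWeight k r M c x ≤
      2 * c * Real.sqrt x - Real.sqrt x ^ 4 / (2 * ((k * r : ℕ) / ((k : ℝ) - 1))) + 3 / 2 := by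
  have hk' : (2 : ℝ) ≤ k := by exact_mod_cast hk
  have hr0 : (0 : ℝ) < r := by exact_mod_cast hr
  have hx0 : 0 < x := one_pos.trans_le hx.1
  have h := sum_log_one_sub_div_le hr0 hx0.le hx.2 M
  rw [log_add_cast_sub_log hk hr hM, inv_sub_inv_cast hk hr hM] at h
  have h1 : Real.log ((k : ℝ) - 1) ≤ Real.log k := Real.log_le_log (by linarith) (by linarith)
  have h2 : Real.log x ≤ Real.log r := Real.log_le_log hx0 hx.2
  have e : Real.sqrt x ^ 4 = x ^ 2 := by
    rw [show 4 = 2 * 2 from rfl, pow_mul, Real.sq_sqrt hx0.le]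
  have e' : x ^ 2 / (2 * ((k * r : ℕ) / ((k : ℝ) - 1))) =
      x ^ 2 / 2 * (1 / ((k * r : ℕ) / ((k : ℝ) - 1))) := by
    rw [div_mul_div_comm, mul_one]
  rw [e, e', logWeight]
  linarith

theorem le_logWeight {k r M : ℕ} (hk : 2 ≤ k) (hr : 1 ≤ r) (hM : r + 1 + M = k * r)
    (c : ℝ) {x : ℝ} (hx1 : 1 ≤ x) (hxr : x ≤ r / 2) :
    2 * c * Real.sqrt x - Real.sqrt x ^ 4 / (2 * ((k * r : ℕ) / ((k : ℝ) - 1)))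
        - Real.log (k * r : ℕ) - 2 * x ^ 3 / r ^ 2 ≤ logWeight k r M c x := by
  have hk' : (2 : ℝ) ≤ k := by exact_mod_cast hk
  have hr0 : (0 : ℝ) < r := by exact_mod_cast hr
  have hx0 : 0 < x := one_pos.trans_le hx1
  have h := le_sum_log_one_sub_div hr0 hx0.le hxr M
  rw [log_add_cast_sub_log hk hr hM, inv_sub_inv_cast hk hr hM] at h
  have h1 : 0 ≤ Real.log ((k : ℝ) - 1) := Real.log_nonneg (by linarith)
  have h2 : 0 ≤ Real.log x := Real.log_nonneg hx1
  have h3 : Real.log (k * r : ℕ) = Real.log k + Real.log r := by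
    push_cast
    exact Real.log_mul (by positivity) (by positivity)
  have e : Real.sqrt x ^ 4 = x ^ 2 := by
    rw [show 4 = 2 * 2 from rfl, pow_mul, Real.sq_sqrt hx0.le]
  have e' : x ^ 2 / (2 * ((k * r : ℕ) / ((k : ℝ) - 1))) =
      x ^ 2 / 2 * (1 / ((k * r : ℕ) / ((k : ℝ) - 1))) := by
    rw [div_mul_div_comm, mul_one]
  rw [e, e', h3, logWeight]
  linarith

/-- A concave function drops by little between its maximizer and the integer just below it. -/
theorem ConcaveOn.sub_le_apply_floor {f : ℝ → ℝ} {a x : ℝ} (hf : ConcaveOn ℝ (Set.Icc 1 a) f)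
    (hx : x ∈ Set.Icc 1 a) (hx1 : 1 < x) (hle : f 1 ≤ f x) :
    f x - (f x - f 1) / (x - 1) ≤ f (⌊x⌋ : ℝ) := by
  have hpos : 0 < x - 1 := sub_pos.2 hx1
  have hfl : (1 : ℝ) ≤ ⌊x⌋ := by exact_mod_cast Int.le_floor.2 (by exact_mod_cast hx1.le)
  have hfx : (⌊x⌋ : ℝ) ≤ x := Int.floor_le x
  have hxf : x < ⌊x⌋ + 1 := Int.lt_floor_add_one x
  have h := hf.2 (⟨le_rfl, hx.1.trans hx.2⟩ : (1 : ℝ) ∈ Set.Icc 1 a) hx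
    (div_nonneg (sub_nonneg.2 hfx) hpos.le) (div_nonneg (sub_nonneg.2 hfl) hpos.le)
    (by field_simp; ring)
  simp only [smul_eq_mul] at h
  have e : (x - ⌊x⌋) / (x - 1) * 1 + ((⌊x⌋ : ℝ) - 1) / (x - 1) * x = ⌊x⌋ := by
    field_simp; ring
  have e2 : (x - ⌊x⌋) / (x - 1) * f 1 + ((⌊x⌋ : ℝ) - 1) / (x - 1) * f x =
      f x - (x - ⌊x⌋) * ((f x - f 1) / (x - 1)) := by
    field_simp; ring
  rw [e, e2] at h
  have := mul_le_mul_of_nonneg_right (by linarith : x - ⌊x⌋ ≤ 1)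
    (div_nonneg (sub_nonneg.2 hle) hpos.le)
  linarith

theorem exists_isMax_logWeight {k r M : ℕ} (hk : 2 ≤ k) (hr : 72 ≤ r) (hM : r + 1 + M = k * r)
    {c s : ℝ} (hc1 : 1 / 2 < c) (hc2 : c < 3 / 2) (hs : 0 < s)
    (hs3 : s ^ 3 = c * ((k * r : ℕ) / ((k : ℝ) - 1)))
    (hlog : Real.log (k * r : ℕ) + 20 ≤ 3 / 2 * c * s / 2) :
    ∃ x ∈ Set.Icc (1 : ℝ) r,
      (∀ y ∈ Set.Icc (1 : ℝ) r, logWeight k r M c y ≤ logWeight k r M c x) ∧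
      (∀ y ∈ Set.Icc (1 : ℝ) r, logWeight k r M c y = logWeight k r M c x → y = x) ∧
      (⌊x⌋ : ℝ) ∈ Set.Icc (1 : ℝ) r ∧
      |logWeight k r M c x - 3 / 2 * c * s| ≤ Real.log (k * r : ℕ) + 25 ∧
      |logWeight k r M c ⌊x⌋ - 3 / 2 * c * s| ≤ Real.log (k * r : ℕ) + 25 := by
  have hr1 : 1 ≤ r := by omega
  have hr' : (72 : ℝ) ≤ r := by exact_mod_cast hr
  have hk' : (2 : ℝ) ≤ k := by exact_mod_cast hk
  have hlog0 : 0 ≤ Real.log (k * r : ℕ) := Real.log_natCast_nonneg _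
  set f := logWeight k r M c with hf
  set G := 3 / 2 * c * s with hG
  set L := Real.log (k * r : ℕ) with hL
  set N : ℝ := (k * r : ℕ) / ((k : ℝ) - 1) with hNdef
  have hk1 : (0 : ℝ) < k - 1 := by linarith
  have hNr : r ≤ N := by
    rw [hNdef, le_div_iff₀ hk1]; push_cast; nlinarith
  have hN2r : N ≤ 2 * r := by
    rw [hNdef, div_le_iff₀ hk1]; push_cast; nlinarith
  have hN0 : 0 < N := by linarith
  have hconc := strictConcaveOn_logWeight k r M (by linarith : 0 ≤ c)
  obtain ⟨x, hx, hmax⟩ := isCompact_Icc.exists_isMaxOn (Set.nonempty_Icc.2 (by linarith))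
    (continuousOn_logWeight k r M c)
  have hmax' : ∀ y ∈ Set.Icc (1 : ℝ) r, f y ≤ f x := fun y hy => hmax hy
  have hs3le : s ^ 3 ≤ 3 * r := by rw [hs3]; nlinarith
  have hs1 : 1 ≤ s := by
    by_contra! h
    have : s ^ 3 < 1 := pow_lt_one₀ hs.le h (by norm_num)
    nlinarith
  have hs6 : s ^ 6 ≤ 9 * r ^ 2 := by nlinarith [pow_pos hs 3]
  have hs2r : s ^ 2 ≤ r / 2 := by
    by_contra! h
    have : (r / 2 : ℝ) ^ 3 < (s ^ 2) ^ 3 := pow_lt_pow_left₀ h (by positivity) (by norm_num)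
    nlinarith [sq_nonneg (r : ℝ)]
  have hlow : G - L - 18 ≤ f (s ^ 2) := by
    have h := le_logWeight hk hr1 hM c (by nlinarith : 1 ≤ s ^ 2) hs2r
    rw [Real.sqrt_sq hs.le] at h
    have e1 : 2 * c * s - s ^ 4 / (2 * N) = G := by
      have : s ^ 4 = s * (c * N) := by rw [← hs3]; ring
      rw [this, hG]
      field_simp
      ring
    have e2 : 2 * (s ^ 2) ^ 3 / (r : ℝ) ^ 2 ≤ 18 := by
      rw [div_le_iff₀ (by positivity)]
      linarith
    linarith
  have hlow' : G - L - 18 ≤ f x :=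
    hlow.trans (hmax' _ ⟨by nlinarith, by linarith⟩)
  have hup : ∀ y ∈ Set.Icc (1 : ℝ) r, f y ≤ G + 2 := fun y hy => by
    have h1 := logWeight_le hk hr1 hM c hy
    have h2 := two_mul_sub_le hs hs3 (by linarith) (Real.sqrt_nonneg y)
    linarith
  have hone : -L - 3 ≤ f 1 := by
    have h := le_logWeight hk hr1 hM c le_rfl (by linarith : (1 : ℝ) ≤ r / 2)
    have e1 : (1 : ℝ) ^ 4 / (2 * N) ≤ 1 := by
      rw [div_le_iff₀ (by positivity)]; linarith
    have e2 : 2 * (1 : ℝ) ^ 3 / (r : ℝ) ^ 2 ≤ 1 := by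
      rw [div_le_iff₀ (by positivity)]; nlinarith
    rw [Real.sqrt_one] at h
    linarith
  have hsqrt : G / 6 ≤ Real.sqrt x := by
    have h1 := logWeight_le hk hr1 hM c hx
    have h2 : 0 ≤ Real.sqrt x ^ 4 / (2 * N) := by positivity
    have h3 : 2 * c * Real.sqrt x ≤ 3 * Real.sqrt x :=
      mul_le_mul_of_nonneg_right (by linarith) (Real.sqrt_nonneg x)
    linarith
  have hG40 : 40 ≤ G := by linarith
  have hxG : G ^ 2 / 72 ≤ x - 1 := by
    have := Real.sq_sqrt (zero_le_one.trans hx.1)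
    nlinarith
  have hx1 : 1 < x := by nlinarith
  have hfloor : (⌊x⌋ : ℝ) ∈ Set.Icc (1 : ℝ) r :=
    ⟨by exact_mod_cast Int.le_floor.2 (by exact_mod_cast hx.1), (Int.floor_le x).trans hx.2⟩
  have hdrop := hconc.concaveOn.sub_le_apply_floor hx hx1
    (hmax' 1 ⟨le_rfl, by linarith⟩)
  have hquot : (f x - f 1) / (x - 1) ≤ 4 := by
    rw [div_le_iff₀ (by linarith)]
    have h1 := hup x hx
    have h2 : 40 * G ≤ G ^ 2 := by rw [sq]; exact mul_le_mul_of_nonneg_right hG40 (by linarith)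
    linarith
  have hupx := hup x hx
  have hupf := hup _ hfloor
  refine ⟨x, hx, hmax', fun y hy hyx => ?_, hfloor, abs_le.2 ⟨by linarith, by linarith⟩,
    abs_le.2 ⟨by linarith, by linarith⟩⟩
  exact hconc.eq_of_isMaxOn (fun z hz => (hmax' z hz).trans_eq hyx.symm) hmax hy hx

theorem tendsto_log_mul_div_rpow {k n : ℕ → ℕ} {α : ℝ} (hα : 0 < α)
    (hk : ∀ r, 2 ≤ k r) (hn : ∀ r, n r = k r * r)
    (hko : (fun r : ℕ => (k r : ℝ)) =o[atTop] (fun r : ℕ => (n r : ℝ) ^ (1 - α))) (B : ℝ) :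
    Tendsto (fun r : ℕ => (Real.log (n r) + B) / (r : ℝ) ^ ((1 : ℝ) / 3)) atTop (nhds 0) := by
  have hpow : Tendsto (fun r : ℕ => (r : ℝ) ^ ((1 : ℝ) / 3)) atTop atTop :=
    (tendsto_rpow_atTop (by norm_num)).comp tendsto_natCast_atTop_atTop
  have hlog : Tendsto (fun r : ℕ => Real.log r / (r : ℝ) ^ ((1 : ℝ) / 3)) atTop (nhds 0) :=
    (isLittleO_log_rpow_atTop (by norm_num : (0 : ℝ) < 1 / 3)).tendsto_div_nhds_zero.comp
      tendsto_natCast_atTop_atTop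
  have hlogn : Tendsto (fun r : ℕ => Real.log (n r) / (r : ℝ) ^ ((1 : ℝ) / 3)) atTop
      (nhds 0) := by
    have h := hlog.const_mul α⁻¹
    rw [mul_zero] at h
    refine squeeze_zero' (Eventually.of_forall fun r =>
      div_nonneg (Real.log_natCast_nonneg _) (by positivity)) ?_ h
    filter_upwards [hko.bound one_pos, eventually_ge_atTop 1] with r hb hr
    have hr0 : (0 : ℝ) < r := by exact_mod_cast hr
    have hk0 : (0 : ℝ) < k r := by exact_mod_cast (by have := hk r; omega)
    have hnr : (n r : ℝ) = k r * r := by rw [hn r]; push_cast; ring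
    have hn0 : (0 : ℝ) < n r := by rw [hnr]; positivity
    rw [Real.norm_of_nonneg hk0.le, Real.norm_of_nonneg (by positivity), one_mul] at hb
    have h1 : Real.log (k r) ≤ (1 - α) * Real.log (n r) := by
      rw [← Real.log_rpow hn0]
      exact Real.log_le_log hk0 hb
    have h2 : Real.log (n r) = Real.log (k r) + Real.log r := by
      rw [hnr, Real.log_mul hk0.ne' hr0.ne']
    rw [← mul_div_assoc]
    gcongr
    rw [inv_mul_eq_div, le_div_iff₀ hα]
    linarith
  have h := hlogn.add (hpow.const_div_atTop B)
  rw [add_zero] at h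
  exact h.congr fun r => by rw [add_div]

theorem exists_tendsto_zero_mul_one_add {f G b : ℕ → ℝ} (hG : ∀ᶠ r in atTop, 0 < G r)
    (hfG : ∀ᶠ r in atTop, |f r - G r| ≤ b r)
    (hb : Tendsto (fun r => b r / G r) atTop (nhds 0)) :
    ∃ e : ℕ → ℝ, Tendsto e atTop (nhds 0) ∧ ∀ᶠ r in atTop, f r = G r * (1 + e r) := by
  refine ⟨fun r => (f r - G r) / G r, ?_, ?_⟩
  · refine squeeze_zero_norm' ?_ hb
    filter_upwards [hG, hfG] with r h1 h2
    rw [Real.norm_eq_abs, abs_div, abs_of_pos h1]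
    gcongr
  · filter_upwards [hG] with r h1
    field_simp
    ring

/-- the function `H_{n,ε}` has a unique maximum `x_*` on `[1, r]`
for large `r`, and both `H_{n,ε}(x_*)` and `H_{n,ε}(⌊x_*⌋)` are
`(1 + ε/2)^{4/3} (3/2) (n/λ)^{1/3} (1 + o(1))`. -/
theorem stmt_9 (k n : ℕ → ℕ) (α : ℝ) (hα1 : 0 < α) (hα2 : α < 1)
    (hk : ∀ r, 2 ≤ k r) (hn : ∀ r, n r = k r * r)
    (hko : (fun r : ℕ => (k r : ℝ)) =o[atTop] (fun r : ℕ => (n r : ℝ) ^ (1 - α)))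
    (ε : ℝ) (hε1 : -1 < ε) (hε2 : ε < 1)
    (H : ℕ → ℝ → ℝ)
    (hH : ∀ r x, H r x = Real.log
      (((k r : ℝ) - 1) * x * (k r : ℝ) ^ (x - 1) *
        (Real.Gamma (r : ℝ) / Real.Gamma ((r : ℝ) - x + 1)) *
        (Real.Gamma ((n r : ℝ) - x) / Real.Gamma (n r : ℝ)) *
        Real.exp ((2 + ε) * Real.sqrt x))) :
    ∃ xstar : ℕ → ℝ,
      (∀ᶠ r : ℕ in atTop,
        xstar r ∈ Set.Icc (1 : ℝ) (r : ℝ) ∧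
        (∀ x ∈ Set.Icc (1 : ℝ) (r : ℝ), H r x ≤ H r (xstar r)) ∧
        (∀ x ∈ Set.Icc (1 : ℝ) (r : ℝ), H r x = H r (xstar r) → x = xstar r)) ∧
      ∃ e₁ e₂ : ℕ → ℝ, Tendsto e₁ atTop (nhds 0) ∧ Tendsto e₂ atTop (nhds 0) ∧
        ∀ᶠ r : ℕ in atTop,
          H r (xstar r) =
            (1 + ε / 2) ^ ((4 : ℝ) / 3) * (3 / 2) *
              ((n r : ℝ) / ((k r : ℝ) - 1)) ^ ((1 : ℝ) / 3) * (1 + e₁ r) ∧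
          H r ((⌊xstar r⌋ : ℝ)) =
            (1 + ε / 2) ^ ((4 : ℝ) / 3) * (3 / 2) *
              ((n r : ℝ) / ((k r : ℝ) - 1)) ^ ((1 : ℝ) / 3) * (1 + e₂ r) := by
  set c := 1 + ε / 2 with hc
  have hc1 : 1 / 2 < c := by linarith
  have hc2 : c < 3 / 2 := by linarith
  set G : ℕ → ℝ := fun r => c ^ ((4 : ℝ) / 3) * (3 / 2) *
    ((n r : ℝ) / ((k r : ℝ) - 1)) ^ ((1 : ℝ) / 3) with hG
  have hNr : ∀ r : ℕ, (r : ℝ) ≤ (n r : ℝ) / ((k r : ℝ) - 1) := fun r => by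
    have hk' : (2 : ℝ) ≤ k r := by exact_mod_cast hk r
    rw [le_div_iff₀ (by linarith), hn r]
    push_cast
    nlinarith [(Nat.cast_nonneg r : (0 : ℝ) ≤ r)]
  have hGr : ∀ r : ℕ, c ^ ((4 : ℝ) / 3) * (3 / 2) * (r : ℝ) ^ ((1 : ℝ) / 3) ≤ G r := fun r => by
    simp only [hG]
    gcongr
    exact hNr r
  have hGpos : ∀ᶠ r in atTop, 0 < G r := by
    filter_upwards [eventually_ge_atTop 1] with r hr
    have hr0 : (0 : ℝ) < r := by exact_mod_cast hr
    exact lt_of_lt_of_le (by positivity) (hGr r)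
  have hbG : Tendsto (fun r => (Real.log (n r) + 25) / G r) atTop (nhds 0) := by
    have h := (tendsto_log_mul_div_rpow hα1 hk hn hko 25).const_mul
      (c ^ ((4 : ℝ) / 3) * (3 / 2))⁻¹
    rw [mul_zero] at h
    have hlog : ∀ r, 0 ≤ Real.log (n r) := fun r => Real.log_natCast_nonneg _
    refine squeeze_zero' ?_ ?_ h
    · filter_upwards [hGpos] with r hr
      have := hlog r
      positivity
    · filter_upwards [eventually_ge_atTop 1] with r hr
      have hr0 : (0 : ℝ) < r := by exact_mod_cast hr
      have := hlog r
      rw [inv_mul_eq_div, div_div, mul_comm ((r : ℝ) ^ _)]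
      gcongr
      exact hGr r
  have hmain : ∀ᶠ r : ℕ in atTop, ∃ x : ℝ, x ∈ Set.Icc (1 : ℝ) (r : ℝ) ∧
      (∀ y ∈ Set.Icc (1 : ℝ) (r : ℝ), H r y ≤ H r x) ∧
      (∀ y ∈ Set.Icc (1 : ℝ) (r : ℝ), H r y = H r x → y = x) ∧
      |H r x - G r| ≤ Real.log (n r) + 25 ∧
      |H r (⌊x⌋ : ℝ) - G r| ≤ Real.log (n r) + 25 := by
    filter_upwards [eventually_ge_atTop 72, hGpos,
      hbG.eventually_le_const (by norm_num : (0 : ℝ) < 1 / 2)] with r hr hG0 hsmall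
    have hr1 : 1 ≤ r := by omega
    have hk1 : (0 : ℝ) < k r - 1 := by
      have : (2 : ℝ) ≤ k r := by exact_mod_cast hk r
      linarith
    obtain ⟨M, hM⟩ := Nat.exists_eq_add_of_le
      (show r + 1 ≤ k r * r by nlinarith [hk r])
    have hHf : ∀ x ∈ Set.Icc (1 : ℝ) r, H r x = logWeight (k r) r M c x := fun x hx => by
      rw [hH, hn r]
      exact log_eq_logWeight (hk r) hr1 hM.symm ε hx
    have hN : (0 : ℝ) < (n r : ℝ) / ((k r : ℝ) - 1) :=
      lt_of_lt_of_le (Nat.cast_pos.2 hr1) (hNr r)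
    have hcN : 0 < c * ((n r : ℝ) / ((k r : ℝ) - 1)) := by positivity
    set s : ℝ := (c * ((n r : ℝ) / ((k r : ℝ) - 1))) ^ ((1 : ℝ) / 3) with hs
    have hs3 : s ^ 3 = c * ((n r : ℝ) / ((k r : ℝ) - 1)) := by
      rw [hs, ← Real.rpow_natCast, ← Real.rpow_mul hcN.le]
      norm_num
    have hGs : 3 / 2 * c * s = G r := by
      have : c ^ ((4 : ℝ) / 3) = c * c ^ ((1 : ℝ) / 3) := by
        rw [show (4 : ℝ) / 3 = 1 + 1 / 3 by norm_num, Real.rpow_add (by linarith), Real.rpow_one]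
      simp only [hG]
      rw [this, hs, Real.mul_rpow (by linarith) hN.le]
      ring
    rw [div_le_iff₀ hG0] at hsmall
    obtain ⟨x, hx, hmax, huniq, hfl, h1, h2⟩ := exists_isMax_logWeight (hk r) hr hM.symm hc1 hc2
      (Real.rpow_pos_of_pos hcN _) (by rw [← hn r]; exact hs3)
      (by rw [← hn r, ← hs, hGs]; linarith)
    rw [← hn r, ← hs, hGs] at h1 h2
    refine ⟨x, hx, fun y hy => ?_, fun y hy hyx => huniq y hy ?_, ?_, ?_⟩
    · rw [hHf y hy, hHf x hx]
      exact hmax y hy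
    · rw [← hHf y hy, ← hHf x hx, hyx]
    · rwa [hHf x hx]
    · rwa [hHf _ hfl]
  obtain ⟨xstar, hxstar⟩ := hmain.choice
  obtain ⟨e₁, he₁, h₁⟩ := exists_tendsto_zero_mul_one_add (f := fun r => H r (xstar r)) hGpos
    (hxstar.mono fun r h => h.2.2.2.1) hbG
  obtain ⟨e₂, he₂, h₂⟩ := exists_tendsto_zero_mul_one_add
    (f := fun r => H r (⌊xstar r⌋ : ℝ)) hGpos (hxstar.mono fun r h => h.2.2.2.2) hbG
  exact ⟨xstar, hxstar.mono fun r h => ⟨h.1, h.2.1, h.2.2.1⟩, e₁, e₂, he₁, he₂, h₁.and h₂⟩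
end
end

section
/- Let k = k(r) ≥ 2 and n = n(r) = k(r)·r be sequences with λ = k − 1 and k = o(n^{1−α}) for some fixed 0 < α < 1 as r → ∞. Let E_n^{{0,k}}(B) denote the expected value of B(f) over uniformly random {0,k}-mappings f on [n]. Then log E_n^{{0,k}}(B) = (3/2)·(n/λ)^{1/3}·(1 + o(1)) as r → ∞. -/
open Filter Finset Asymptotics MeasureTheory

noncomputable section

open scoped Classical

/-- The sum over partitions of `j` of the product of the inverse factorials of the multiplicities;
this is the coefficient of `x ^ j` in `exp (x / (1 - x))`. -/
def partitionWeight (j : ℕ) : ℝ :=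
  ∑ p : Nat.Partition j, ∏ i ∈ Finset.Icc 1 j, ((p.parts.count i).factorial : ℝ)⁻¹

lemma partition_toFinset_subset {j : ℕ} (p : Nat.Partition j) :
    p.parts.toFinset ⊆ Finset.Icc 1 j := by
  intro i hi
  rw [Multiset.mem_toFinset] at hi
  exact Finset.mem_Icc.2 ⟨p.parts_pos hi, p.le_of_mem_parts hi⟩

lemma partition_sum_count_mul {j : ℕ} (p : Nat.Partition j) :
    ∑ i ∈ Finset.Icc 1 j, p.parts.count i * i = j := by
  conv_rhs => rw [← p.parts_sum, Finset.sum_multiset_count_of_subset _ _ (partition_toFinset_subset p)]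
  simp

lemma perm_partition_surjective {α : Type*} [Fintype α] [DecidableEq α] :
    Function.Surjective (Equiv.Perm.partition : Equiv.Perm α → _) := by
  intro p
  have hsum : (p.parts.filter (2 ≤ ·)).sum + (p.parts.filter (¬ 2 ≤ ·)).sum = Fintype.card α := by
    rw [← Multiset.sum_add, Multiset.filter_add_not, p.parts_sum]
  have hrep : p.parts.filter (¬ 2 ≤ ·) =
      Multiset.replicate (p.parts.filter (¬ 2 ≤ ·)).card 1 := by
    rw [Multiset.eq_replicate_card]
    intro b hb
    rw [Multiset.mem_filter] at hb
    have := p.parts_pos hb.1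
    omega
  obtain ⟨σ, hσ⟩ := (Equiv.Perm.exists_with_cycleType_iff α (m := p.parts.filter (2 ≤ ·))).2
    ⟨by omega, fun a ha => (Multiset.mem_filter.1 ha).2⟩
  refine ⟨σ, Nat.Partition.ext ?_⟩
  rw [Equiv.Perm.parts_partition, ← Equiv.Perm.sum_cycleType, hσ]
  conv_rhs => rw [← Multiset.filter_add_not (2 ≤ ·) p.parts, hrep]
  congr 2
  have := congrArg Multiset.sum hrep
  rw [Multiset.sum_replicate, smul_eq_mul, mul_one] at this
  omega

lemma card_partition_eq_mul {α : Type*} [Fintype α] [DecidableEq α] (σ : Equiv.Perm α) :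
    (Finset.univ.filter fun τ : Equiv.Perm α => τ.partition = σ.partition).card *
      σ.cycleType.prod * ∏ i ∈ Finset.Icc 1 (Fintype.card α), (σ.partition.parts.count i).factorial
      = (Fintype.card α).factorial := by
  have h := Equiv.Perm.card_of_cycleType_mul_eq α σ.cycleType
  have hle : σ.cycleType.sum ≤ Fintype.card α := by
    rw [Equiv.Perm.sum_cycleType]; exact Finset.card_le_univ _
  rw [if_pos ⟨hle, fun a ha => Equiv.Perm.two_le_of_mem_cycleType ha⟩] at h
  rw [← h, mul_assoc, mul_comm (Nat.factorial _), mul_assoc]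
  congr 1
  · congr 1; ext τ
    simp only [Finset.mem_filter, Finset.mem_univ, true_and]
    rw [← Equiv.Perm.partition_eq_of_isConj, Equiv.Perm.isConj_iff_cycleType_eq]
  congr 1
  have h1 : (1 : ℕ) ∉ σ.cycleType := fun h => by
    have := Equiv.Perm.two_le_of_mem_cycleType h
    omega
  have hsub : σ.partition.parts.toFinset ⊆ insert 1 σ.cycleType.toFinset := by
    intro i hi
    rw [Multiset.mem_toFinset, Equiv.Perm.parts_partition, Multiset.mem_add] at hi
    rw [Finset.mem_insert, Multiset.mem_toFinset]
    rcases hi with hi | hi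
    · exact Or.inr hi
    · exact Or.inl (Multiset.eq_of_mem_replicate hi)
  have e1 : ∏ i ∈ Finset.Icc 1 (Fintype.card α), (σ.partition.parts.count i).factorial =
      ∏ i ∈ σ.partition.parts.toFinset, (σ.partition.parts.count i).factorial := by
    symm
    apply Finset.prod_subset (partition_toFinset_subset _)
    intro i _ hi
    rw [Multiset.mem_toFinset] at hi
    rw [Multiset.count_eq_zero_of_notMem hi, Nat.factorial_zero]
  have e2 : ∏ i ∈ σ.partition.parts.toFinset, (σ.partition.parts.count i).factorial =
      ∏ i ∈ insert 1 σ.cycleType.toFinset, (σ.partition.parts.count i).factorial := by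
    apply Finset.prod_subset hsub
    intro i _ hi
    rw [Multiset.mem_toFinset] at hi
    rw [Multiset.count_eq_zero_of_notMem hi, Nat.factorial_zero]
  rw [e1, e2, Finset.prod_insert (by simpa using h1), mul_comm, mul_comm (Nat.factorial _)]
  congr 1
  · apply Finset.prod_congr rfl
    intro i hi
    rw [Multiset.mem_toFinset] at hi
    have : i ≠ 1 := fun h => h1 (h ▸ hi)
    rw [Equiv.Perm.parts_partition, Multiset.count_add, Multiset.count_replicate, if_neg this.symm,
      add_zero]
  · rw [Equiv.Perm.parts_partition, Multiset.count_add, Multiset.count_replicate_self,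
      Multiset.count_eq_zero_of_notMem h1, zero_add, Equiv.Perm.sum_cycleType]

lemma sum_perm_cycleType_prod {α : Type*} [Fintype α] [DecidableEq α] :
    ∑ σ : Equiv.Perm α, (σ.cycleType.prod : ℝ) =
      partitionWeight (Fintype.card α) * (Fintype.card α).factorial := by
  rw [← Finset.sum_fiberwise_of_maps_to (t := Finset.univ) (g := Equiv.Perm.partition)
    (fun _ _ => Finset.mem_univ _), partitionWeight, Finset.sum_mul]
  apply Finset.sum_congr rfl
  intro p _
  obtain ⟨σ, rfl⟩ := perm_partition_surjective p
  have hc : ∀ τ ∈ Finset.univ.filter (fun τ : Equiv.Perm α => τ.partition = σ.partition),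
      (τ.cycleType.prod : ℝ) = σ.cycleType.prod := by
    intro τ hτ
    rw [Finset.mem_filter, ← Equiv.Perm.partition_eq_of_isConj,
      Equiv.Perm.isConj_iff_cycleType_eq] at hτ
    rw [hτ.2]
  rw [Finset.sum_congr rfl hc, Finset.sum_const, nsmul_eq_mul, Finset.prod_inv_distrib,
    ← card_partition_eq_mul σ]
  push_cast
  field_simp

lemma partitionWeight_pos (j : ℕ) : 0 < partitionWeight j :=
  Finset.sum_pos (fun _ _ => Finset.prod_pos fun _ _ => by positivity)
    ⟨default, Finset.mem_univ _⟩

lemma partitionWeight_mul_pow_le (j : ℕ) {x : ℝ} (hx0 : 0 < x) (hx1 : x < 1) :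
    partitionWeight j * x ^ j ≤ Real.exp (x / (1 - x)) := by
  have hterm : ∀ p : Nat.Partition j,
      (∏ i ∈ Finset.Icc 1 j, ((p.parts.count i).factorial : ℝ)⁻¹) * x ^ j =
        ∏ i ∈ Finset.Icc 1 j, (x ^ i) ^ (p.parts.count i) / ((p.parts.count i).factorial : ℝ) := by
    intro p
    have hx : x ^ j = ∏ i ∈ Finset.Icc 1 j, x ^ (p.parts.count i * i) := by
      rw [Finset.prod_pow_eq_pow_sum, partition_sum_count_mul]
    rw [hx]
    rw [← Finset.prod_mul_distrib]
    refine Finset.prod_congr rfl fun i _ => ?_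
    rw [← pow_mul, mul_comm i, div_eq_mul_inv, mul_comm]
  have hcount : ∀ (p : Nat.Partition j), ∀ i ∈ Finset.Icc 1 j,
      p.parts.count i ∈ Finset.range (j + 1) := by
    intro p i hi
    rw [Finset.mem_range, Nat.lt_succ_iff]
    have h1 := Finset.single_le_sum (f := fun i => p.parts.count i * i)
      (fun _ _ => Nat.zero_le _) hi
    rw [partition_sum_count_mul] at h1
    exact (Nat.le_mul_of_pos_right _ (Finset.mem_Icc.1 hi).1).trans h1
  calc partitionWeight j * x ^ j
      = ∑ p : Nat.Partition j, ∏ i ∈ (Finset.Icc 1 j).attach,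
          (x ^ (i : ℕ)) ^ (p.parts.count (i : ℕ)) / ((p.parts.count (i : ℕ)).factorial : ℝ) := by
        rw [partitionWeight, Finset.sum_mul]
        refine Finset.sum_congr rfl fun p _ => ?_
        rw [hterm p, ← Finset.prod_attach]
    _ ≤ ∑ q ∈ (Finset.Icc 1 j).pi fun _ => Finset.range (j + 1), ∏ i ∈ (Finset.Icc 1 j).attach,
          (x ^ (i : ℕ)) ^ (q i i.2) / ((q i i.2).factorial : ℝ) := by
        have hinj : Function.Injective
            (fun (p : Nat.Partition j) (i : ℕ) (_ : i ∈ Finset.Icc 1 j) => p.parts.count i) := by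
          intro p p' h
          refine Nat.Partition.ext (Multiset.ext.2 fun i => ?_)
          by_cases hi : i ∈ Finset.Icc 1 j
          · exact congrFun (congrFun h i) hi
          · rw [Multiset.count_eq_zero_of_notMem fun h' =>
                hi (partition_toFinset_subset p (Multiset.mem_toFinset.2 h')),
              Multiset.count_eq_zero_of_notMem fun h' =>
                hi (partition_toFinset_subset p' (Multiset.mem_toFinset.2 h'))]
        rw [← Finset.sum_image (s := Finset.univ)
          (g := fun (p : Nat.Partition j) (i : ℕ) (_ : i ∈ Finset.Icc 1 j) => p.parts.count i)
          (f := fun q => ∏ i ∈ (Finset.Icc 1 j).attach,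
            (x ^ (i : ℕ)) ^ (q i i.2) / ((q i i.2).factorial : ℝ)) hinj.injOn]
        refine Finset.sum_le_sum_of_subset_of_nonneg ?_ fun _ _ _ =>
          Finset.prod_nonneg fun _ _ => by positivity
        intro q hq
        obtain ⟨p, -, rfl⟩ := Finset.mem_image.1 hq
        exact Finset.mem_pi.2 (hcount p)
    _ = ∏ i ∈ Finset.Icc 1 j, ∑ c ∈ Finset.range (j + 1), (x ^ i) ^ c / (c.factorial : ℝ) := by
        rw [Finset.prod_sum]
    _ ≤ ∏ i ∈ Finset.Icc 1 j, Real.exp (x ^ i) :=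
        Finset.prod_le_prod (fun _ _ => Finset.sum_nonneg fun _ _ => by positivity)
          fun i _ => Real.sum_le_exp_of_nonneg (by positivity) _
    _ = Real.exp (∑ i ∈ Finset.Icc 1 j, x ^ i) := (Real.exp_sum _ _).symm
    _ ≤ Real.exp (x / (1 - x)) := by
        rw [Real.exp_le_exp, ← Finset.Ico_add_one_right_eq_Icc, geom_sum_Ico' hx1.ne (by omega)]
        rw [pow_one]
        exact div_le_div_of_nonneg_right (by linarith [pow_pos hx0 (j + 1)]) (by linarith)

lemma partitionWeight_le_exp (j : ℕ) : partitionWeight j ≤ Real.exp (2 * √j) := by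
  rcases Nat.eq_zero_or_pos j with rfl | hj
  · simp [partitionWeight]
  have hs : 0 < √(j : ℝ) := Real.sqrt_pos.2 (by exact_mod_cast hj)
  have hsj : √(j : ℝ) * √(j : ℝ) = j := Real.mul_self_sqrt (by positivity)
  generalize √(j : ℝ) = s at hs hsj ⊢
  have h := partitionWeight_mul_pow_le j (x := s / (1 + s)) (by positivity)
    (by rw [div_lt_one (by positivity)]; linarith)
  have h1 : s / (1 + s) / (1 - s / (1 + s)) = s := by field_simp; ring
  have h2 : Real.exp (-s) ≤ (s / (1 + s)) ^ j := by
    have h3 : Real.exp (-(1 / s)) ≤ s / (1 + s) := by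
      rw [Real.exp_neg, inv_le_comm₀ (Real.exp_pos _) (by positivity), inv_div]
      refine le_trans (le_of_eq ?_) (Real.add_one_le_exp (1 / s))
      field_simp
    refine le_trans (le_of_eq ?_) (pow_le_pow_left₀ (Real.exp_pos _).le h3 j)
    rw [← Real.exp_nat_mul, ← hsj]
    congr 1
    field_simp
  rw [h1] at h
  have h4 := (mul_le_mul_of_nonneg_left h2 (partitionWeight_pos j).le).trans h
  rw [Real.exp_neg, ← div_eq_mul_inv, div_le_iff₀ (Real.exp_pos _), ← Real.exp_add] at h4
  rwa [two_mul]

lemma choose_le_coeff_sum_X_pow (j l m : ℕ) (hm : m + 1 ≤ j) :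
    m.choose l ≤
      ((∑ i ∈ Finset.Icc 1 j, (Polynomial.X : Polynomial ℕ) ^ i) ^ (l + 1)).coeff (m + 1) := by
  induction l generalizing m with
  | zero =>
    rw [zero_add, pow_one, Polynomial.finsetSum_coeff, Nat.choose_zero_right]
    refine le_trans ?_ (Finset.single_le_sum (f := fun i =>
      ((Polynomial.X : Polynomial ℕ) ^ i).coeff (m + 1)) (fun _ _ => Nat.zero_le _)
      (Finset.mem_Icc.2 ⟨Nat.le_add_left 1 m, hm⟩))
    simp
  | succ l ih =>
    have hsum : ∀ N : ℕ, ∑ t ∈ Finset.range N, t.choose l = N.choose (l + 1) := by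
      intro N
      induction N with
      | zero => simp
      | succ N ihN => rw [Finset.sum_range_succ, ihN, Nat.choose_succ_succ, add_comm]
    rw [pow_succ, Finset.mul_sum, Polynomial.finsetSum_coeff, ← hsum m,
      ← Finset.sum_range_reflect]
    refine le_trans (Finset.sum_le_sum (g := fun i => ((∑ i ∈ Finset.Icc 1 j,
      (Polynomial.X : Polynomial ℕ) ^ i) ^ (l + 1) * Polynomial.X ^ (i + 1)).coeff (m + 1))
      fun i hi => ?_) ?_
    · rw [Finset.mem_range] at hi
      rw [Polynomial.coeff_mul_X_pow', if_pos (by omega)]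
      have := ih (m - 1 - i) (by omega)
      rwa [show m - 1 - i + 1 = m + 1 - (i + 1) by omega] at this
    · rw [Finset.range_eq_Ico]
      refine (Finset.sum_Ico_add' (fun i : ℕ => ((∑ i ∈ Finset.Icc 1 j,
        (Polynomial.X : Polynomial ℕ) ^ i) ^ (l + 1) * Polynomial.X ^ i).coeff (m + 1))
        0 m 1).le.trans ?_
      refine Finset.sum_le_sum_of_subset fun i hi => ?_
      rw [Finset.mem_Ico] at hi
      exact Finset.mem_Icc.2 ⟨by omega, by omega⟩

lemma coeff_sum_X_pow_le_partitionWeight (j l : ℕ) :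
    (((∑ i ∈ Finset.Icc 1 j, (Polynomial.X : Polynomial ℕ) ^ i) ^ l).coeff j : ℝ) ≤
      l.factorial * partitionWeight j := by
  have hcoeff : ((∑ i ∈ Finset.Icc 1 j, (Polynomial.X : Polynomial ℕ) ^ i) ^ l).coeff j =
      ∑ q ∈ (Finset.piAntidiag (Finset.Icc 1 j) l).filter
        (fun q => ∑ i ∈ Finset.Icc 1 j, q i * i = j), Nat.multinomial (Finset.Icc 1 j) q := by
    rw [Finset.sum_pow_eq_sum_piAntidiag, Polynomial.finsetSum_coeff, Finset.sum_filter]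
    refine Finset.sum_congr rfl fun q _ => ?_
    rw [← Polynomial.C_eq_natCast, Polynomial.coeff_C_mul]
    simp_rw [← pow_mul]
    rw [Finset.prod_pow_eq_pow_sum, Polynomial.coeff_X_pow]
    simp_rw [mul_comm, eq_comm (a := j)]
    split_ifs <;> simp
  have hinj : Function.Injective
      (fun (p : Nat.Partition j) (i : ℕ) => p.parts.count i) :=
    fun p p' h => Nat.Partition.ext (Multiset.ext.2 (congrFun h))
  have himage : (Finset.piAntidiag (Finset.Icc 1 j) l).filter
        (fun q => ∑ i ∈ Finset.Icc 1 j, q i * i = j) ⊆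
      Finset.univ.image (fun (p : Nat.Partition j) (i : ℕ) => p.parts.count i) := by
    intro q hq
    rw [Finset.mem_filter, Finset.mem_piAntidiag] at hq
    have hcount : ∀ a, (∑ i ∈ Finset.Icc 1 j, Multiset.replicate (q i) i).count a = q a := by
      intro a
      rw [Multiset.count_sum']
      simp_rw [Multiset.count_replicate]
      rw [Finset.sum_ite_eq']
      split_ifs with h
      · rfl
      · by_contra h'
        exact h (hq.1.2 a (Ne.symm h'))
    refine Finset.mem_image.2 ⟨⟨∑ i ∈ Finset.Icc 1 j, Multiset.replicate (q i) i, ?_, ?_⟩,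
      Finset.mem_univ _, funext hcount⟩
    · intro a ha
      obtain ⟨i, hi, hai⟩ := Multiset.mem_sum.1 ha
      rw [Multiset.eq_of_mem_replicate hai]
      exact (Finset.mem_Icc.1 hi).1
    · rw [Multiset.sum_sum]
      simpa using hq.2
  rw [hcoeff]
  calc ((∑ q ∈ (Finset.piAntidiag (Finset.Icc 1 j) l).filter
        (fun q => ∑ i ∈ Finset.Icc 1 j, q i * i = j), Nat.multinomial (Finset.Icc 1 j) q : ℕ) : ℝ)
      = ∑ q ∈ (Finset.piAntidiag (Finset.Icc 1 j) l).filter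
        (fun q => ∑ i ∈ Finset.Icc 1 j, q i * i = j),
          l.factorial * ∏ i ∈ Finset.Icc 1 j, ((q i).factorial : ℝ)⁻¹ := by
        rw [Nat.cast_sum]
        refine Finset.sum_congr rfl fun q hq => ?_
        rw [Finset.mem_filter, Finset.mem_piAntidiag] at hq
        have := Nat.multinomial_spec (Finset.Icc 1 j) q
        rw [hq.1.1] at this
        rw [← this, Finset.prod_inv_distrib]
        push_cast
        have h0 : ∏ i ∈ Finset.Icc 1 j, ((q i).factorial : ℝ) ≠ 0 :=
          Finset.prod_ne_zero_iff.2 fun _ _ => by positivity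
        field_simp
    _ ≤ ∑ q ∈ Finset.univ.image (fun (p : Nat.Partition j) (i : ℕ) => p.parts.count i),
          l.factorial * ∏ i ∈ Finset.Icc 1 j, ((q i).factorial : ℝ)⁻¹ :=
        Finset.sum_le_sum_of_subset_of_nonneg himage fun _ _ _ => by positivity
    _ = l.factorial * partitionWeight j := by
        rw [Finset.sum_image hinj.injOn, partitionWeight, Finset.mul_sum]

lemma factorial_mul_exp_le (a : ℕ) :
    ((a + 1).factorial : ℝ) * Real.exp a ≤ ((a : ℝ) + 1) ^ (a + 2) := by
  induction a with
  | zero => simp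
  | succ a ih =>
    have h1 : Real.exp 1 * ((a : ℝ) + 1) ^ (a + 2) ≤ ((a : ℝ) + 2) ^ (a + 2) := by
      have h2 : Real.exp (1 / ((a : ℝ) + 2)) * ((a : ℝ) + 1) ≤ (a : ℝ) + 2 := by
        have h3 := Real.add_one_le_exp (-(1 / ((a : ℝ) + 2)))
        have h4 : -(1 / ((a : ℝ) + 2)) + 1 = (a + 1) / (a + 2) := by field_simp; ring
        rw [h4, Real.exp_neg, div_le_iff₀ (by positivity), inv_mul_eq_div,
          le_div_iff₀ (Real.exp_pos _)] at h3
        linarith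
      have h5 := pow_le_pow_left₀ (by positivity) h2 (a + 2)
      have h6 : ((a + 2 : ℕ) : ℝ) * (1 / ((a : ℝ) + 2)) = 1 := by
        push_cast
        exact mul_one_div_cancel (by positivity)
      rwa [mul_pow, ← Real.exp_nat_mul, h6] at h5
    rw [Nat.factorial_succ]
    push_cast
    rw [Real.exp_add]
    calc ((a : ℝ) + 1 + 1) * ((a + 1).factorial : ℝ) * (Real.exp a * Real.exp 1)
        = ((a : ℝ) + 2) * Real.exp 1 * (((a + 1).factorial : ℝ) * Real.exp a) := by ring
      _ ≤ ((a : ℝ) + 2) * Real.exp 1 * ((a : ℝ) + 1) ^ (a + 2) := by gcongr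
      _ = ((a : ℝ) + 2) * (Real.exp 1 * ((a : ℝ) + 1) ^ (a + 2)) := by ring
      _ ≤ ((a : ℝ) + 2) * ((a : ℝ) + 2) ^ (a + 2) := by gcongr
      _ = ((a : ℝ) + 1 + 1) ^ (a + 1 + 2) := by ring

lemma exp_le_partitionWeight_sq (j : ℕ) (hj : 2 ≤ j) :
    Real.exp (2 * j - 3) ≤ (j : ℝ) ^ 3 * partitionWeight (j ^ 2) := by
  obtain ⟨a, rfl⟩ := Nat.exists_eq_add_of_le' hj
  have h1 := choose_le_coeff_sum_X_pow ((a + 2) ^ 2) (a + 1) ((a + 2) ^ 2 - 1)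
    (by have : 0 < (a + 2) ^ 2 := by positivity
        omega)
  rw [Nat.sub_add_cancel (by nlinarith)] at h1
  have h2 := coeff_sum_X_pow_le_partitionWeight ((a + 2) ^ 2) (a + 1 + 1)
  have h3 : (((a : ℝ) + 2) * (a + 1)) ^ (a + 1) / ((a + 1).factorial : ℝ) ≤
      (((a + 2) ^ 2 - 1).choose (a + 1) : ℝ) := by
    refine le_trans ?_ (Nat.pow_le_choose (α := ℝ) (a + 1) ((a + 2) ^ 2 - 1))
    gcongr
    have : (a + 2) * (a + 1) ≤ (a + 2) ^ 2 - 1 + 1 - (a + 1) := by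
      rw [Nat.sub_add_cancel (by nlinarith)]
      apply Nat.le_sub_of_add_le
      nlinarith
    exact_mod_cast this
  have h4 : (((a + 2) ^ 2 - 1).choose (a + 1) : ℝ) ≤ _ := (by exact_mod_cast h1 :
    (((a + 2) ^ 2 - 1).choose (a + 1) : ℝ) ≤ _).trans h2
  have h5 := h3.trans h4
  rw [div_le_iff₀ (by positivity), mul_pow] at h5
  have h6 := factorial_mul_exp_le a
  have h7 := factorial_mul_exp_le (a + 1)
  push_cast at h7 ⊢
  have hW := partitionWeight_pos ((a + 2) ^ 2)
  generalize partitionWeight ((a + 2) ^ 2) = W at *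
  have e1 : Real.exp (2 * ((a : ℝ) + 2) - 3) = Real.exp a * Real.exp (a + 1) := by
    rw [← Real.exp_add]; ring_nf
  rw [e1]
  have hf1 : (0 : ℝ) < (a + 1).factorial := by positivity
  have hf2 : (0 : ℝ) < (a + 1 + 1).factorial := by positivity
  refine le_of_mul_le_mul_left ?_ (mul_pos hf1 hf2)
  calc ((a + 1).factorial : ℝ) * (a + 1 + 1).factorial * (Real.exp a * Real.exp (a + 1))
      = ((a + 1).factorial * Real.exp a) * ((a + 1 + 1).factorial * Real.exp (a + 1)) := by ring
    _ ≤ ((a : ℝ) + 1) ^ (a + 2) * ((a : ℝ) + 1 + 1) ^ (a + 1 + 2) := by gcongr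
    _ = ((a : ℝ) + 1) * (a + 2) ^ 2 * (((a : ℝ) + 2) ^ (a + 1) * (a + 1) ^ (a + 1)) := by ring
    _ ≤ ((a : ℝ) + 1) * (a + 2) ^ 2 * ((a + 1 + 1).factorial * W * (a + 1).factorial) := by gcongr
    _ ≤ ((a : ℝ) + 2) * (a + 2) ^ 2 * ((a + 1 + 1).factorial * W * (a + 1).factorial) := by
        gcongr; linarith
    _ = _ := by ring

lemma card_perm_extending_mul {α : Type*} [Fintype α] [DecidableEq α] {m : ℕ} (x y : Fin m ↪ α) :
    (Finset.univ.filter fun τ : Equiv.Perm α => ∀ i, τ (x i) = y i).card *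
      (Fintype.card α).descFactorial m = (Fintype.card α).factorial := by
  have hconst : ∀ z : Fin m ↪ α,
      (Finset.univ.filter fun τ : Equiv.Perm α => ∀ i, τ (x i) = z i).card =
        (Finset.univ.filter fun τ : Equiv.Perm α => ∀ i, τ (x i) = y i).card := by
    intro z
    have : MulAction.IsPretransitive (Equiv.Perm α) (Fin m ↪ α) :=
      Equiv.Perm.isMultiplyPretransitive α m
    obtain ⟨ρ, hρ⟩ := MulAction.exists_smul_eq (Equiv.Perm α) z y
    have hρ' : ∀ i, ρ (z i) = y i := fun i => DFunLike.congr_fun hρ i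
    refine Finset.card_equiv (Equiv.mulLeft ρ) fun τ => ?_
    simp [← hρ']
  have hsum : ∑ z : Fin m ↪ α,
      (Finset.univ.filter fun τ : Equiv.Perm α => ∀ i, τ (x i) = z i).card =
        (Fintype.card α).factorial := by
    rw [← Fintype.card_perm, ← Finset.card_univ,
      Finset.card_eq_sum_card_fiberwise (f := fun τ : Equiv.Perm α => x.trans τ.toEmbedding)
        (t := Finset.univ) (fun _ _ => Finset.mem_coe.2 (Finset.mem_univ _))]
    refine Finset.sum_congr rfl fun z _ => ?_
    congr 1
    ext τ
    simp [DFunLike.ext_iff]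
  rw [Finset.sum_congr rfl fun z _ => hconst z, Finset.sum_const, Finset.card_univ,
    Fintype.card_embedding_eq, Fintype.card_fin, smul_eq_mul] at hsum
  rw [mul_comm, hsum]

/-- The number of injective `m`-tuples of fixed points of `f`. -/
def fixedTuples {α : Type*} [Fintype α] [DecidableEq α] (m : ℕ) (f : α → α) : ℕ :=
  (Finset.univ.filter fun x : Fin m ↪ α => ∀ i, f (x i) = x i).card

lemma sum_perm_fixedTuples {α : Type*} [Fintype α] [DecidableEq α] (m : ℕ) :
    ∑ σ : Equiv.Perm α, fixedTuples m σ =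
      if m ≤ Fintype.card α then (Fintype.card α).factorial else 0 := by
  have hcomm : ∑ σ : Equiv.Perm α, fixedTuples m σ = ∑ x : Fin m ↪ α,
      (Finset.univ.filter fun τ : Equiv.Perm α => ∀ i, τ (x i) = x i).card := by
    simp_rw [fixedTuples, Finset.card_filter]
    exact Finset.sum_comm
  rw [hcomm]
  split_ifs with h
  · refine Nat.eq_of_mul_eq_mul_right (Nat.descFactorial_pos.2 h) ?_
    rw [Finset.sum_mul, Finset.sum_congr rfl fun x _ => card_perm_extending_mul x x,
      Finset.sum_const, Finset.card_univ, Fintype.card_embedding_eq, Fintype.card_fin,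
      smul_eq_mul, mul_comm]
  · have : IsEmpty (Fin m ↪ α) := by
      rw [← Fintype.card_eq_zero_iff, Fintype.card_embedding_eq, Fintype.card_fin,
        Nat.descFactorial_eq_zero_iff_lt]
      omega
    simp

lemma sum_fixedTuples_comp_mul {α : Type*} [Fintype α] [DecidableEq α] (m : ℕ) (f : α → α) :
    (∑ τ : Equiv.Perm α, fixedTuples m (f ∘ τ)) * (Fintype.card α).descFactorial m =
      (Finset.univ.filter fun y : Fin m → α => Function.Injective (f ∘ y)).card *
        (Fintype.card α).factorial := by
  have h1 : ∀ τ : Equiv.Perm α, fixedTuples m (f ∘ τ) =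
      ((Finset.univ.filter fun y : Fin m → α => Function.Injective (f ∘ y)).filter
        fun y => ∀ i, τ (f (y i)) = y i).card := by
    intro τ
    refine Finset.card_bij (fun x _ i => τ (x i)) ?_ ?_ ?_
    · intro x hx
      simp only [Finset.mem_filter, Finset.mem_univ, true_and, Function.comp_apply] at hx ⊢
      refine ⟨fun i j hij => x.injective ?_, fun i => by rw [hx i]⟩
      simpa [hx] using hij
    · intro x _ x' _ h
      ext i
      exact τ.injective (congrFun h i)
    · intro y hy
      simp only [Finset.mem_filter, Finset.mem_univ, true_and] at hy
      refine ⟨⟨f ∘ y, hy.1⟩, ?_, funext fun i => ?_⟩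
      · simp [hy.2]
      · simp [hy.2]
  simp_rw [h1, Finset.card_filter _ (Finset.filter _ _)]
  rw [Finset.sum_comm, Finset.sum_mul, Finset.card_eq_sum_ones (Finset.filter _ _),
    Finset.sum_mul]
  refine Finset.sum_congr rfl fun y hy => ?_
  rw [Finset.mem_filter] at hy
  rw [← Finset.card_filter, one_mul]
  exact card_perm_extending_mul ⟨f ∘ y, hy.2⟩ ⟨y, hy.2.of_comp⟩

lemma mem_zkMaps {n k : ℕ} {f : Fin n → Fin n} : f ∈ zkMaps n k ↔ IsZKMap k f := by
  simp [zkMaps]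

lemma comp_perm_mem_zkMaps {n k : ℕ} {f : Fin n → Fin n} (τ : Equiv.Perm (Fin n)) :
    f ∘ τ ∈ zkMaps n k ↔ f ∈ zkMaps n k := by
  have h : ∀ y, (Finset.univ.filter fun x => (f ∘ τ) x = y).card =
      (Finset.univ.filter fun x => f x = y).card :=
    fun y => Finset.card_equiv τ fun x => by simp
  simp only [mem_zkMaps, IsZKMap, h]

lemma sum_zkMaps_comp_perm {n k : ℕ} {M : Type*} [AddCommMonoid M] (F : (Fin n → Fin n) → M)
    (τ : Equiv.Perm (Fin n)) : ∑ f ∈ zkMaps n k, F (f ∘ τ) = ∑ f ∈ zkMaps n k, F f :=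
  Finset.sum_equiv (τ.symm.arrowCongr (Equiv.refl _)) (fun _ => (comp_perm_mem_zkMaps τ).symm)
    fun _ _ => rfl

lemma card_range_zkMap {k r : ℕ} (hk : 0 < k) {f : Fin (k * r) → Fin (k * r)}
    (hf : IsZKMap k f) : (Finset.univ.image f).card = r := by
  have h := Finset.card_eq_sum_card_image f Finset.univ
  rw [Finset.card_univ, Fintype.card_fin, Finset.sum_congr rfl (g := fun _ => k), Finset.sum_const,
    smul_eq_mul] at h
  · exact (Nat.eq_of_mul_eq_mul_left hk (h.trans (mul_comm _ _))).symm
  · intro y hy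
    obtain ⟨x, -, rfl⟩ := Finset.mem_image.1 hy
    refine (hf (f x)).resolve_left fun h0 => ?_
    rw [Finset.card_eq_zero, Finset.filter_eq_empty_iff] at h0
    exact h0 (Finset.mem_univ x) rfl

lemma card_injective_comp_zkMap {k r : ℕ} (hk : 0 < k) (m : ℕ) {f : Fin (k * r) → Fin (k * r)}
    (hf : IsZKMap k f) :
    (Finset.univ.filter fun y : Fin m → Fin (k * r) => Function.Injective (f ∘ y)).card =
      k ^ m * r.descFactorial m := by
  have hmaps : ∀ y ∈ Finset.univ.filter
      (fun y : Fin m → Fin (k * r) => Function.Injective (f ∘ y)),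
      f ∘ y ∈ (Finset.univ : Finset (Fin m ↪ Finset.univ.image f)).image
        fun z i => (z i : Fin (k * r)) := by
    intro y hy
    refine Finset.mem_image.2 ⟨⟨fun i => ⟨f (y i), by simp⟩, fun i j hij => ?_⟩,
      Finset.mem_univ _, rfl⟩
    exact (Finset.mem_filter.1 hy).2 (Subtype.ext_iff.1 hij)
  rw [Finset.card_eq_sum_card_fiberwise hmaps, Finset.sum_image]
  · rw [Finset.sum_congr rfl (g := fun _ => k ^ m), Finset.sum_const, Finset.card_univ,
      Fintype.card_embedding_eq, Fintype.card_fin, Fintype.card_coe, card_range_zkMap hk hf,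
      smul_eq_mul, mul_comm]
    intro z _
    have : (Finset.univ.filter fun y : Fin m → Fin (k * r) => Function.Injective (f ∘ y)).filter
        (fun y => f ∘ y = fun i => (z i : Fin (k * r))) =
        Fintype.piFinset fun i => Finset.univ.filter fun x => f x = z i := by
      ext y
      simp only [Finset.mem_filter, Finset.mem_univ, true_and, Fintype.mem_piFinset]
      refine ⟨fun h i => congrFun h.2 i, fun h => ⟨fun i j hij => ?_, funext h⟩⟩
      exact z.injective (Subtype.ext ((h i).symm.trans (hij.trans (h j))))
    rw [this, Fintype.card_piFinset, Finset.prod_congr rfl (g := fun _ => k), Finset.prod_const,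
      Finset.card_univ, Fintype.card_fin]
    intro i _
    obtain ⟨x, -, hx⟩ := Finset.mem_image.1 (z i).2
    refine (hf (z i)).resolve_left fun h0 => ?_
    rw [Finset.card_eq_zero, Finset.filter_eq_empty_iff] at h0
    exact h0 (Finset.mem_univ x) hx
  · intro z _ z' _ h
    ext i
    exact congrArg Fin.val (congrFun h i)

lemma sum_zkMaps_fixedTuples_mul {k r : ℕ} (hk : 0 < k) (m : ℕ) :
    (∑ f ∈ zkMaps (k * r) k, fixedTuples m f) * (k * r).descFactorial m =
      (zkMaps (k * r) k).card * (k ^ m * r.descFactorial m) := by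
  refine Nat.eq_of_mul_eq_mul_left (Nat.factorial_pos (k * r)) ?_
  have h1 : (k * r).factorial * ∑ f ∈ zkMaps (k * r) k, fixedTuples m f =
      ∑ f ∈ zkMaps (k * r) k, ∑ τ : Equiv.Perm (Fin (k * r)), fixedTuples m (f ∘ τ) := by
    rw [Finset.sum_comm, Finset.sum_congr rfl fun τ _ => sum_zkMaps_comp_perm (fixedTuples m) τ,
      Finset.sum_const, Finset.card_univ, Fintype.card_perm, Fintype.card_fin, smul_eq_mul]
  rw [← mul_assoc, h1, Finset.sum_mul, Finset.card_eq_sum_ones, Finset.sum_mul, Finset.mul_sum]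
  refine Finset.sum_congr rfl fun f hf => ?_
  have h2 := sum_fixedTuples_comp_mul m f
  rw [Fintype.card_fin, card_injective_comp_zkMap hk m (mem_zkMaps.1 hf)] at h2
  rw [h2, one_mul, mul_comm]

lemma zkMaps_nonempty (k r : ℕ) : (zkMaps (k * r) k).Nonempty := by
  rcases Nat.eq_zero_or_pos k with rfl | hk
  · exact ⟨id, mem_zkMaps.2 fun y => absurd y.2 (by simp)⟩
  refine ⟨fun x => ⟨x / k, (Nat.div_le_self _ _).trans_lt x.2⟩, mem_zkMaps.2 fun y => ?_⟩
  by_cases hy : (y : ℕ) < r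
  · right
    have hlt : ∀ t : Fin k, k * y + t < k * r := fun t => by
      have := Nat.mul_le_mul_left k (Nat.succ_le_of_lt hy)
      rw [Nat.mul_succ] at this
      omega
    have : (Finset.univ.filter fun x : Fin (k * r) =>
        (⟨x / k, (Nat.div_le_self _ _).trans_lt x.2⟩ : Fin (k * r)) = y) =
        Finset.univ.image fun t : Fin k => (⟨k * y + t, hlt t⟩ : Fin (k * r)) := by
      ext x
      simp only [Finset.mem_filter, Finset.mem_univ, true_and, Finset.mem_image, Fin.ext_iff]
      constructor
      · intro h
        exact ⟨⟨x % k, Nat.mod_lt _ hk⟩, by rw [← h]; exact Nat.div_add_mod _ _⟩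
      · rintro ⟨t, ht⟩
        rw [← ht, Nat.mul_add_div hk, Nat.div_eq_of_lt t.2, add_zero]
    rw [this, Finset.card_image_of_injective, Finset.card_univ, Fintype.card_fin]
    intro t t' h
    simpa [Fin.ext_iff] using h
  · left
    rw [Finset.card_eq_zero, Finset.filter_eq_empty_iff]
    intro x _ h
    rw [← h] at hy
    exact hy (Nat.div_lt_of_lt_mul x.2)

lemma mem_cyclicSet {n : ℕ} {f : Fin n → Fin n} {x : Fin n} :
    x ∈ cyclicSet f ↔ x ∈ Function.periodicPts f := by
  simp [cyclicSet, Function.periodicPts, Function.IsPeriodicPt, Function.IsFixedPt]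

lemma exists_perm_cyclicSet {n : ℕ} (f : Fin n → Fin n) :
    ∃ π : Equiv.Perm (cyclicSet f), ∀ x, (π x : Fin n) = f x := by
  have hb := Function.bijOn_periodicPts f
  refine ⟨Equiv.ofBijective
    (fun x => ⟨f x, mem_cyclicSet.2 (hb.mapsTo (mem_cyclicSet.1 x.2))⟩) ?_, fun _ => rfl⟩
  refine Finite.injective_iff_bijective.1 fun x y h => Subtype.ext ?_
  exact hb.injOn (mem_cyclicSet.1 x.2) (mem_cyclicSet.1 y.2) (Subtype.ext_iff.1 h)

lemma iterate_coe_perm {α : Type*} {S : Finset α} {f : α → α} {σ : Equiv.Perm S}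
    (h : ∀ x, (σ x : α) = f x) (m : ℕ) (x : S) : (((σ ^ m) x : S) : α) = f^[m] x := by
  induction m with
  | zero => rfl
  | succ m ih => rw [pow_succ', Equiv.Perm.mul_apply, h, ih, Function.iterate_succ_apply']

lemma cyclicSet_eq_of_eqOn_compl {n : ℕ} {f g : Fin n → Fin n} {σ : Equiv.Perm (cyclicSet f)}
    (hσ : ∀ x, (σ x : Fin n) = g x) (hfg : ∀ x ∉ cyclicSet f, g x = f x) :
    cyclicSet g = cyclicSet f := by
  have hiter : ∀ m (x : cyclicSet f), g^[m] x ∈ cyclicSet f := fun m x => by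
    rw [← iterate_coe_perm hσ]
    exact ((σ ^ m) x).2
  ext x
  constructor
  · intro hx
    by_contra hxf
    obtain ⟨p, hp, hpx⟩ := mem_cyclicSet.1 hx
    have hout : ∀ i, g^[i] x ∉ cyclicSet f := by
      intro i hi
      refine hxf ?_
      have h1 := hiter (p * i - i) ⟨_, hi⟩
      rw [← Function.iterate_add_apply, Nat.sub_add_cancel (Nat.le_mul_of_pos_left i hp)] at h1
      rwa [(hpx.mul_const i).eq] at h1
    have heq : ∀ i, g^[i] x = f^[i] x := by
      intro i
      induction i with
      | zero => rfl
      | succ i ih => rw [Function.iterate_succ_apply', hfg _ (hout i), ih,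
          Function.iterate_succ_apply']
    exact hxf (mem_cyclicSet.2 ⟨p, hp, (heq p).symm.trans hpx⟩)
  · intro hx
    refine mem_cyclicSet.2 ⟨orderOf σ, orderOf_pos σ, ?_⟩
    have := iterate_coe_perm hσ (orderOf σ) ⟨x, hx⟩
    rw [pow_orderOf_eq_one] at this
    exact this.symm

lemma cyclicSet_comp_ofSubtype {n : ℕ} {f : Fin n → Fin n} {S : Finset (Fin n)}
    (hS : cyclicSet f = S) (τ : Equiv.Perm S) :
    cyclicSet (f ∘ Equiv.Perm.ofSubtype τ) = S := by
  subst hS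
  obtain ⟨π, hπ⟩ := exists_perm_cyclicSet f
  refine cyclicSet_eq_of_eqOn_compl (σ := π * τ) (fun x => ?_) fun x hx => ?_
  · rw [Equiv.Perm.mul_apply, hπ, Function.comp_apply, Equiv.Perm.ofSubtype_apply_coe]
  · rw [Function.comp_apply, Equiv.Perm.ofSubtype_apply_of_not_mem τ hx]

/-- Conditionally on its cyclic nodes, a random `{0,k}`-mapping acts on them as a uniform random
permutation. -/
lemma sum_zkMaps_eq_sum_Zmap {n k : ℕ} {F : (Fin n → Fin n) → ℝ}
    {Ψ : (S : Finset (Fin n)) → Equiv.Perm S → ℝ} {Φ : ℕ → ℝ}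
    (hF : ∀ (g : Fin n → Fin n) (σ : Equiv.Perm (cyclicSet g)),
      (∀ x, (σ x : Fin n) = g x) → F g = Ψ (cyclicSet g) σ)
    (hΨ : ∀ S : Finset (Fin n), ∑ σ, Ψ S σ = Φ S.card * S.card.factorial) :
    ∑ f ∈ zkMaps n k, F f = ∑ f ∈ zkMaps n k, Φ (Zmap f) := by
  rw [← Finset.sum_fiberwise (zkMaps n k) cyclicSet F,
    ← Finset.sum_fiberwise (zkMaps n k) cyclicSet fun f => Φ (Zmap f)]
  refine Finset.sum_congr rfl fun S _ => ?_
  have hpos : (S.card.factorial : ℝ) ≠ 0 := by positivity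
  refine mul_right_cancel₀ hpos ?_
  have hmem : ∀ (τ : Equiv.Perm S) (f : Fin n → Fin n),
      f ∈ (zkMaps n k).filter (fun f => cyclicSet f = S) →
      f ∘ Equiv.Perm.ofSubtype τ ∈ (zkMaps n k).filter (fun f => cyclicSet f = S) := by
    intro τ f hf
    rw [Finset.mem_filter] at hf ⊢
    exact ⟨(comp_perm_mem_zkMaps _).2 hf.1, cyclicSet_comp_ofSubtype hf.2 τ⟩
  have hcancel : ∀ (τ τ' : Equiv.Perm S) (f : Fin n → Fin n), τ * τ' = 1 →
      (f ∘ Equiv.Perm.ofSubtype τ) ∘ Equiv.Perm.ofSubtype τ' = f := by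
    intro τ τ' f h
    rw [Function.comp_assoc, ← Equiv.Perm.coe_mul, ← map_mul, h, map_one]
    rfl
  have hre : ∀ τ : Equiv.Perm S,
      ∑ f ∈ (zkMaps n k).filter (fun f => cyclicSet f = S), F (f ∘ Equiv.Perm.ofSubtype τ) =
        ∑ f ∈ (zkMaps n k).filter (fun f => cyclicSet f = S), F f := fun τ =>
    Finset.sum_bij' (fun f _ => f ∘ Equiv.Perm.ofSubtype τ)
      (fun f _ => f ∘ Equiv.Perm.ofSubtype τ⁻¹) (hmem τ) (hmem τ⁻¹)
      (fun f _ => hcancel _ _ f (mul_inv_cancel τ)) (fun f _ => hcancel _ _ f (inv_mul_cancel τ))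
      fun _ _ => rfl
  calc (∑ f ∈ (zkMaps n k).filter (fun f => cyclicSet f = S), F f) * S.card.factorial
      = ∑ τ : Equiv.Perm S, ∑ f ∈ (zkMaps n k).filter (fun f => cyclicSet f = S),
          F (f ∘ Equiv.Perm.ofSubtype τ) := by
        rw [Finset.sum_congr rfl fun τ _ => hre τ, Finset.sum_const, Finset.card_univ,
          Fintype.card_perm, Fintype.card_coe, nsmul_eq_mul, mul_comm]
    _ = ∑ f ∈ (zkMaps n k).filter (fun f => cyclicSet f = S), ∑ τ : Equiv.Perm S,
          F (f ∘ Equiv.Perm.ofSubtype τ) := Finset.sum_comm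
    _ = _ := by
        rw [Finset.sum_mul]
        refine Finset.sum_congr rfl fun f hf => ?_
        have hfS := (Finset.mem_filter.1 hf).2
        subst hfS
        obtain ⟨π, hπ⟩ := exists_perm_cyclicSet f
        have hval : ∀ τ, F (f ∘ Equiv.Perm.ofSubtype τ) = Ψ (cyclicSet f) (π * τ) := by
          intro τ
          have key : ∀ S, cyclicSet (f ∘ Equiv.Perm.ofSubtype τ) = S → ∀ σ : Equiv.Perm S,
              (∀ x, (σ x : Fin n) = (f ∘ Equiv.Perm.ofSubtype τ) x) →
              F (f ∘ Equiv.Perm.ofSubtype τ) = Ψ S σ := by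
            rintro _ rfl σ hσ
            exact hF _ σ hσ
          refine key _ (cyclicSet_comp_ofSubtype rfl τ) _ fun x => ?_
          rw [Equiv.Perm.mul_apply, hπ, Function.comp_apply, Equiv.Perm.ofSubtype_apply_coe]
        rw [Finset.sum_congr rfl fun τ _ => hval τ, Zmap, ← hΨ]
        exact Equiv.sum_comp (Equiv.mulLeft π) (Ψ (cyclicSet f))

lemma fixedTuples_eq_of_perm_cyclicSet {n : ℕ} (m : ℕ) {f : Fin n → Fin n}
    {σ : Equiv.Perm (cyclicSet f)} (hσ : ∀ x, (σ x : Fin n) = f x) :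
    fixedTuples m f = fixedTuples m σ := by
  symm
  refine Finset.card_bij (fun x _ => x.trans (Function.Embedding.subtype _)) ?_ ?_ ?_
  · intro x hx
    simp only [Finset.mem_filter, Finset.mem_univ, true_and] at hx ⊢
    intro i
    have := congrArg Subtype.val (hx i)
    rw [hσ] at this
    exact this
  · intro x _ y _ h
    ext i
    exact congrArg Fin.val (DFunLike.congr_fun h i)
  · intro y hy
    simp only [Finset.mem_filter, Finset.mem_univ, true_and] at hy
    refine ⟨⟨fun i => ⟨y i, mem_cyclicSet.2 ⟨1, one_pos, hy i⟩⟩, fun i j h =>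
      y.injective (Subtype.ext_iff.1 h)⟩, ?_, rfl⟩
    simp only [Finset.mem_filter, Finset.mem_univ, true_and]
    intro i
    refine Subtype.ext ?_
    rw [hσ]
    exact hy i

lemma card_le_Zmap_mul {k r : ℕ} (hk : 0 < k) (m : ℕ) :
    ((zkMaps (k * r) k).filter fun f => m ≤ Zmap f).card * (k * r).descFactorial m =
      (zkMaps (k * r) k).card * (k ^ m * r.descFactorial m) := by
  rw [← sum_zkMaps_fixedTuples_mul hk m]
  congr 1
  have h := sum_zkMaps_eq_sum_Zmap (n := k * r) (k := k) (F := fun f => (fixedTuples m f : ℝ))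
    (Ψ := fun S σ => (fixedTuples m σ : ℝ)) (Φ := fun z => if m ≤ z then 1 else 0)
    (fun g σ hσ => by rw [fixedTuples_eq_of_perm_cyclicSet m hσ]) fun S => by
      have := sum_perm_fixedTuples (α := S) m
      rw [Fintype.card_coe] at this
      rw [← Nat.cast_sum, this]
      split_ifs <;> simp
  rw [Finset.card_filter]
  exact_mod_cast h.symm

lemma Bmap_eq_prod_cycleType {n : ℕ} {f : Fin n → Fin n}
    {σ : Equiv.Perm (cyclicSet f)} (hσ : ∀ x, (σ x : Fin n) = f x) :
    Bmap f = σ.cycleType.prod := by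
  set ρ := Equiv.Perm.ofSubtype σ with hρ
  have hρσ : ρ.cycleType = σ.cycleType := Equiv.Perm.cycleType_ofSubtype
  have hiter : ∀ m, ∀ x ∈ cyclicSet f, (ρ ^ m) x = f^[m] x := by
    intro m x hx
    rw [hρ, ← map_pow, ← iterate_coe_perm hσ m ⟨x, hx⟩]
    exact Equiv.Perm.ofSubtype_apply_coe (σ ^ m) ⟨x, hx⟩
  have hsupp : ∀ x ∈ ρ.support, x ∈ cyclicSet f := by
    intro x hx
    by_contra h
    exact Equiv.Perm.mem_support.1 hx (Equiv.Perm.ofSubtype_apply_of_not_mem σ h)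
  have hfix : ∀ x ∈ cyclicSet f, ((cyclicSet f).filter fun y => ∃ m, f^[m] x = y) =
      if x ∈ ρ.support then (ρ.cycleOf x).support else {x} := by
    intro x hx
    ext y
    split_ifs with h
    · rw [Finset.mem_filter, Equiv.Perm.mem_support_cycleOf_iff]
      constructor
      · rintro ⟨-, m, rfl⟩
        exact ⟨⟨m, by rw [zpow_natCast, hiter m x hx]⟩, h⟩
      · rintro ⟨hs, -⟩
        obtain ⟨m, hm⟩ := hs.exists_nat_pow_eq
        refine ⟨hsupp y (hs.mem_support_iff.1 h), m, by rw [← hiter m x hx, hm]⟩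
    · rw [Finset.mem_filter, Finset.mem_singleton]
      have h1 : ∀ m, f^[m] x = x := fun m => by
        rw [← hiter m x hx]
        exact Equiv.Perm.pow_apply_eq_self_of_apply_eq_self (Equiv.Perm.notMem_support.1 h) m
      constructor
      · rintro ⟨-, m, rfl⟩
        exact h1 m
      · rintro rfl
        exact ⟨hx, 0, rfl⟩
  rw [← hρσ, Bmap, Equiv.Perm.cycleType_def]
  change _ = ∏ c ∈ ρ.cycleFactorsFinset, c.support.card
  have himage : ∏ c ∈ ρ.cycleFactorsFinset, c.support.card =
      ∏ s ∈ ρ.cycleFactorsFinset.image Equiv.Perm.support, s.card := by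
    rw [Finset.prod_image]
    intro c hc d hd h
    by_contra hne
    have := (Equiv.Perm.cycleFactorsFinset_pairwise_disjoint ρ hc hd hne).disjoint_support
    rw [← show c.support = d.support from h, disjoint_self, Finset.bot_eq_empty,
      Equiv.Perm.support_eq_empty_iff] at this
    exact (Equiv.Perm.mem_cycleFactorsFinset_iff.1 hc).1.ne_one this
  rw [himage]
  symm
  refine Finset.prod_subset ?_ ?_
  · intro s hs
    obtain ⟨c, hc, rfl⟩ := Finset.mem_image.1 hs
    obtain ⟨x, hx⟩ := (Equiv.Perm.mem_cycleFactorsFinset_iff.1 hc).1.nonempty_support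
    have hxρ := Equiv.Perm.mem_cycleFactorsFinset_support_le hc hx
    refine Finset.mem_image.2 ⟨x, hsupp x hxρ, ?_⟩
    rw [hfix x (hsupp x hxρ), if_pos hxρ, Equiv.Perm.cycle_is_cycleOf hx hc]
  · intro s hs hns
    obtain ⟨x, hx, rfl⟩ := Finset.mem_image.1 hs
    rw [hfix x hx] at hns ⊢
    split_ifs at hns ⊢ with h
    · exact absurd (Finset.mem_image_of_mem _
        (Equiv.Perm.cycleOf_mem_cycleFactorsFinset_iff.2 h)) hns
    · exact Finset.card_singleton x

lemma zkExp_Bmap_eq (n k : ℕ) : zkExp n k (fun f => (Bmap f : ℝ)) =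
    (∑ f ∈ zkMaps n k, partitionWeight (Zmap f)) / (zkMaps n k).card := by
  have h := sum_zkMaps_eq_sum_Zmap (n := n) (k := k) (F := fun f => (Bmap f : ℝ))
    (Ψ := fun S σ => (σ.cycleType.prod : ℝ)) (Φ := partitionWeight)
    (fun g σ hσ => by rw [Bmap_eq_prod_cycleType hσ]) fun S => by
      simpa using sum_perm_cycleType_prod (α := S)
  rw [zkExp, h]

/-- The probability that a random `{0,k}`-mapping on `[kr]` has at least `m` cyclic nodes. -/
def zkTail (k r m : ℕ) : ℝ := zkProb (k * r) k fun f => m ≤ Zmap f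

lemma zkTail_eq_card_div (k r m : ℕ) : zkTail k r m =
    ((zkMaps (k * r) k).filter fun f => m ≤ Zmap f).card / ((zkMaps (k * r) k).card : ℝ) := by
  rw [zkTail, zkProb]
  congr

lemma zkTail_eq {k r m : ℕ} (hk : 0 < k) (hm : m ≤ r) :
    zkTail k r m = ∏ i ∈ Finset.range m, ((k : ℝ) * (r - i) / (k * r - i)) := by
  have hN : ((zkMaps (k * r) k).card : ℝ) ≠ 0 :=
    Nat.cast_ne_zero.2 (zkMaps_nonempty k r).card_pos.ne'
  have hr : r ≤ k * r := Nat.le_mul_of_pos_left r hk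
  have hcast : ∀ N : ℕ, m ≤ N →
      ((N.descFactorial m : ℕ) : ℝ) = ∏ i ∈ Finset.range m, ((N : ℝ) - i) := by
    intro N hN
    rw [Nat.descFactorial_eq_prod_range, Nat.cast_prod]
    refine Finset.prod_congr rfl fun i hi => ?_
    rw [Nat.cast_sub ((Finset.mem_range.1 hi).le.trans hN)]
  have hD : ((k * r).descFactorial m : ℝ) ≠ 0 :=
    Nat.cast_ne_zero.2 (Nat.descFactorial_pos.2 (hm.trans hr)).ne'
  have h := card_le_Zmap_mul (r := r) hk m
  rw [Finset.prod_div_distrib, Finset.prod_mul_distrib, Finset.prod_const, Finset.card_range,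
    ← hcast r hm, ← Nat.cast_mul k r, ← hcast _ (hm.trans hr), zkTail_eq_card_div,
    div_eq_div_iff hN hD]
  have h' := congrArg (Nat.cast : ℕ → ℝ) h
  push_cast at h'
  linarith

lemma Zmap_le {k r : ℕ} (hk : 0 < k) {f : Fin (k * r) → Fin (k * r)}
    (hf : f ∈ zkMaps (k * r) k) : Zmap f ≤ r := by
  refine (Finset.card_le_card fun x hx => ?_).trans (card_range_zkMap hk (mem_zkMaps.1 hf)).le
  obtain ⟨y, -, hy⟩ := (Function.bijOn_periodicPts f).surjOn (mem_cyclicSet.1 hx)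
  exact Finset.mem_image.2 ⟨y, Finset.mem_univ _, hy⟩

lemma zkExp_Bmap_le_sum {k r : ℕ} (hk : 0 < k) :
    zkExp (k * r) k (fun f => (Bmap f : ℝ)) ≤
      ∑ m ∈ Finset.range (r + 1), zkTail k r m * partitionWeight m := by
  have hN : (0 : ℝ) < (zkMaps (k * r) k).card := Nat.cast_pos.2 (zkMaps_nonempty k r).card_pos
  rw [zkExp_Bmap_eq, div_le_iff₀ hN, Finset.sum_mul]
  calc ∑ f ∈ zkMaps (k * r) k, partitionWeight (Zmap f)
      ≤ ∑ f ∈ zkMaps (k * r) k, ∑ m ∈ Finset.range (r + 1),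
          if m ≤ Zmap f then partitionWeight m else 0 := by
        refine Finset.sum_le_sum fun f hf => ?_
        have h0 : ∀ m ∈ Finset.range (r + 1),
            0 ≤ if m ≤ Zmap f then partitionWeight m else 0 := fun m _ => by
          split_ifs
          exacts [(partitionWeight_pos m).le, le_rfl]
        refine le_trans (by simp) (Finset.single_le_sum h0
          (Finset.mem_range.2 (Nat.lt_succ_of_le (Zmap_le hk hf))))
    _ = ∑ m ∈ Finset.range (r + 1), zkTail k r m * partitionWeight m *
          (zkMaps (k * r) k).card := by
        rw [Finset.sum_comm]
        refine Finset.sum_congr rfl fun m _ => ?_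
        rw [← Finset.sum_filter, Finset.sum_const, nsmul_eq_mul, zkTail_eq_card_div]
        field_simp
    _ ≤ _ := le_rfl

lemma mul_le_zkExp_Bmap {k r : ℕ} (m : ℕ) :
    (zkTail k r m - zkTail k r (m + 1)) * partitionWeight m ≤
      zkExp (k * r) k (fun f => (Bmap f : ℝ)) := by
  have hN : (0 : ℝ) < (zkMaps (k * r) k).card := Nat.cast_pos.2 (zkMaps_nonempty k r).card_pos
  have hcard : ((zkMaps (k * r) k).filter fun f => m ≤ Zmap f).card =
      ((zkMaps (k * r) k).filter fun f => m + 1 ≤ Zmap f).card +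
        ((zkMaps (k * r) k).filter fun f => Zmap f = m).card := by
    rw [← Finset.card_union_of_disjoint]
    · congr 1
      ext f
      simp only [Finset.mem_filter, Finset.mem_union, ← and_or_left]
      refine and_congr_right fun _ => ?_
      omega
    · refine Finset.disjoint_filter.2 fun f _ h => ?_
      omega
  have hcard' := congrArg (Nat.cast : ℕ → ℝ) hcard
  push_cast at hcard'
  rw [zkExp_Bmap_eq, zkTail_eq_card_div, zkTail_eq_card_div, ← sub_div, div_mul_eq_mul_div, hcard',
    add_sub_cancel_left]
  refine div_le_div_of_nonneg_right ?_ hN.le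
  calc _ = ∑ f ∈ (zkMaps (k * r) k).filter (fun f => Zmap f = m), partitionWeight (Zmap f) := by
        rw [Finset.sum_congr rfl (g := fun _ => partitionWeight m), Finset.sum_const, nsmul_eq_mul]
        intro f hf
        rw [(Finset.mem_filter.1 hf).2]
    _ ≤ _ := Finset.sum_le_sum_of_subset_of_nonneg (Finset.filter_subset _ _)
        fun f _ _ => (partitionWeight_pos _).le

lemma sum_range_cast (m : ℕ) : ∑ i ∈ Finset.range m, (i : ℝ) = m * (m - 1) / 2 := by
  induction m with
  | zero => simp
  | succ m ih =>
    rw [Finset.sum_range_succ, ih]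
    push_cast
    ring

lemma zkTail_le_exp {k r m : ℕ} {x : ℝ} (hk : 2 ≤ k) (hx : 0 < x) (hkx : x * (k - 1) = k * r)
    (hm : m ≤ r) : zkTail k r m ≤ Real.exp (-(m * (m - 1) / (2 * x))) := by
  have hk' : (2 : ℝ) ≤ k := by exact_mod_cast hk
  rw [zkTail_eq (by omega) hm, show -(m * (m - 1) / (2 * x)) =
    ∑ i ∈ Finset.range m, -((i : ℝ) / x) by
      rw [Finset.sum_neg_distrib, ← Finset.sum_div, sum_range_cast]; field_simp, Real.exp_sum]
  refine Finset.prod_le_prod (fun i hi => ?_) fun i hi => ?_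
  all_goals
    have hi' : (i : ℝ) + 1 ≤ r := by exact_mod_cast (Finset.mem_range.1 hi).trans_le hm
    have hi0 : (0 : ℝ) ≤ i := Nat.cast_nonneg i
    have hkr : (0 : ℝ) < k * r - i := by nlinarith
  · exact div_nonneg (mul_nonneg (by linarith) (by linarith)) hkr.le
  · refine le_trans ?_ (Real.add_one_le_exp _)
    rw [div_le_iff₀ hkr, ← hkx]
    have h1 : (-((i : ℝ) / x) + 1) * (x * (k - 1) - i) = k * r - k * i + i * i / x := by
      rw [← hkx]
      field_simp
      ring
    rw [h1]
    have : 0 ≤ (i : ℝ) * i / x := by positivity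
    linarith

lemma exp_neg_le_zkTail {k r m : ℕ} {x j : ℝ} (hk : 2 ≤ k) (hx : 0 < x)
    (hkx : x * (k - 1) = k * r) (hj : 2 < j) (hm : m * j ≤ 2 * r) :
    Real.exp (-(j / (j - 2) * (m ^ 2 / (2 * x)))) ≤ zkTail k r m := by
  have hk' : (2 : ℝ) ≤ k := by exact_mod_cast hk
  have hm0 : (0 : ℝ) ≤ m := Nat.cast_nonneg m
  have hmr : m ≤ r := by
    have : (m : ℝ) ≤ r := by nlinarith
    exact_mod_cast this
  have hj2 : 0 < j - 2 := by linarith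
  have hle : -(j / (j - 2) * (m ^ 2 / (2 * x))) ≤
      ∑ i ∈ Finset.range m, -(j / (j - 2) * (i / x)) := by
    rw [Finset.sum_neg_distrib, ← Finset.mul_sum, ← Finset.sum_div, sum_range_cast]
    refine neg_le_neg (mul_le_mul_of_nonneg_left ?_ (by positivity))
    rw [div_div]
    gcongr
    nlinarith
  rw [zkTail_eq (by omega) hmr]
  refine (Real.exp_le_exp.2 hle).trans ?_
  rw [Real.exp_sum]
  refine Finset.prod_le_prod (fun i _ => (Real.exp_pos _).le) fun i hi => ?_
  have him : (i : ℝ) + 1 ≤ m := by exact_mod_cast Finset.mem_range.1 hi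
  have hi0 : (0 : ℝ) ≤ i := Nat.cast_nonneg i
  have hmr' : (m : ℝ) ≤ r := by exact_mod_cast hmr
  have hkr : (0 : ℝ) < k * r - i := by nlinarith
  have hri : (0 : ℝ) < r - i := by linarith
  rw [Real.exp_neg, inv_le_comm₀ (Real.exp_pos _) (by positivity), inv_div]
  refine le_trans ?_ (Real.add_one_le_exp _)
  have h1 : ((k : ℝ) * r - i) / (k * (r - i)) = r / (r - i) * (i / x) + 1 := by
    have hr : (r : ℝ) = x * (k - 1) / k := by field_simp; linarith
    have hx' : (i : ℝ) / x = i * (k - 1) / (k * r) := by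
      rw [← hkx]
      have : (k : ℝ) - 1 ≠ 0 := by linarith
      field_simp
    rw [hx']
    have : (r : ℝ) ≠ 0 := by linarith
    field_simp
    ring
  rw [h1]
  have h2 : (r : ℝ) / (r - i) ≤ j / (j - 2) := by
    rw [div_le_div_iff₀ hri hj2]
    nlinarith
  have := mul_le_mul_of_nonneg_right h2 (div_nonneg hi0 hx.le)
  linarith

lemma zkTail_div_le_sub {k r m : ℕ} {x : ℝ} (hk : 2 ≤ k) (hx : 0 < x)
    (hkx : x * (k - 1) = k * r) (hm : 1 ≤ m) (hmr : m + 1 ≤ r) :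
    zkTail k r m / x ≤ zkTail k r m - zkTail k r (m + 1) := by
  have hk' : (2 : ℝ) ≤ k := by exact_mod_cast hk
  have hm' : (1 : ℝ) ≤ m := by exact_mod_cast hm
  have hmr' : (m : ℝ) + 1 ≤ r := by exact_mod_cast hmr
  have hkr : (0 : ℝ) < k * r - m := by nlinarith
  have h0 : 0 ≤ zkTail k r m := div_nonneg (Nat.cast_nonneg _) (Nat.cast_nonneg _)
  have hs : zkTail k r (m + 1) = zkTail k r m * (k * (r - m) / (k * r - m)) := by
    rw [zkTail_eq (by omega) hmr, zkTail_eq (by omega) (by omega), Finset.prod_range_succ]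
  have h1 : 1 / x ≤ 1 - (k : ℝ) * (r - m) / (k * r - m) := by
    rw [one_sub_div hkr.ne', div_le_div_iff₀ hx hkr, ← hkx]
    nlinarith [mul_nonneg (sub_nonneg.2 hm') (mul_nonneg hx.le (by linarith : (0:ℝ) ≤ k - 1))]
  rw [hs]
  calc zkTail k r m / x = zkTail k r m * (1 / x) := by ring
    _ ≤ zkTail k r m * (1 - (k : ℝ) * (r - m) / (k * r - m)) := mul_le_mul_of_nonneg_left h1 h0
    _ = _ := by ring

lemma four_mul_mul_pow_le (s y : ℝ) : 4 * s * y ^ 3 ≤ s ^ 4 + 3 * y ^ 4 := by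
  nlinarith [mul_nonneg (sq_nonneg (s - y)) (by positivity : 0 ≤ (s + y) ^ 2 + 2 * y ^ 2)]

lemma log_zkExp_Bmap_le {k r : ℕ} {y : ℝ} (hk : 2 ≤ k) (hy : 1 ≤ y)
    (hky : y ^ 3 * (k - 1) = k * r) (hpos : 0 < zkExp (k * r) k (fun f => (Bmap f : ℝ))) :
    Real.log (zkExp (k * r) k (fun f => (Bmap f : ℝ))) ≤ 3 / 2 * y + (2 + 3 * Real.log y) := by
  have hk' : (2 : ℝ) ≤ k := by exact_mod_cast hk
  have hy3 : 1 ≤ y ^ 3 := one_le_pow₀ hy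
  have hr : (r : ℝ) ≤ y ^ 3 := by
    have h0 : (0 : ℝ) ≤ r := Nat.cast_nonneg r
    nlinarith
  have hterm : ∀ m ∈ Finset.range (r + 1),
      zkTail k r m * partitionWeight m ≤ Real.exp (3 / 2 * y + 1 / 2) := by
    intro m hm
    have hmr : m ≤ r := Nat.lt_succ_iff.1 (Finset.mem_range.1 hm)
    have hmr' : (m : ℝ) ≤ r := by exact_mod_cast hmr
    refine (mul_le_mul (zkTail_le_exp hk (by positivity) hky hmr) (partitionWeight_le_exp m)
      (partitionWeight_pos m).le (Real.exp_pos _).le).trans ?_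
    rw [← Real.exp_add, Real.exp_le_exp]
    have hs := four_mul_mul_pow_le (√m) y
    have hsq : √(m : ℝ) ^ 2 = m := Real.sq_sqrt (Nat.cast_nonneg m)
    have h4 : √(m : ℝ) ^ 4 = (m : ℝ) ^ 2 := by
      rw [pow_mul (√(m : ℝ)) 2 2, hsq]
    rw [h4] at hs
    have : 2 * √(m : ℝ) - 3 / 2 * y - 1 / 2 ≤ m * (m - 1) / (2 * y ^ 3) := by
      rw [le_div_iff₀ (by positivity)]
      nlinarith
    linarith
  have hsum := (zkExp_Bmap_le_sum (r := r) (by omega : 0 < k)).trans (Finset.sum_le_sum hterm)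
  rw [Finset.sum_const, Finset.card_range, nsmul_eq_mul] at hsum
  have hle : zkExp (k * r) k (fun f => (Bmap f : ℝ)) ≤
      2 * y ^ 3 * Real.exp (3 / 2 * y + 1 / 2) := by
    refine hsum.trans (mul_le_mul_of_nonneg_right ?_ (Real.exp_pos _).le)
    push_cast
    linarith
  have hlog := Real.log_le_log hpos hle
  rw [Real.log_mul (by positivity) (by positivity), Real.log_mul (by positivity) (by positivity),
    Real.log_pow, Real.log_exp] at hlog
  have := Real.log_two_lt_d9
  push_cast at hlog
  linarith

lemma le_log_zkExp_Bmap {k r : ℕ} {y : ℝ} (hk : 2 ≤ k) (hy : 3 ≤ y)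
    (hky : y ^ 3 * (k - 1) = k * r) :
    0 < zkExp (k * r) k (fun f => (Bmap f : ℝ)) ∧
    3 / 2 * y - (8 + 6 * Real.log y) ≤
      Real.log (zkExp (k * r) k (fun f => (Bmap f : ℝ))) := by
  have hk' : (2 : ℝ) ≤ k := by exact_mod_cast hk
  have hy3 : 0 < y ^ 3 := by positivity
  have hr : y ^ 3 ≤ 2 * r := by nlinarith
  set j := ⌊y⌋₊
  have hjy : (j : ℝ) ≤ y := Nat.floor_le (by linarith)
  have hyj : y < j + 1 := Nat.lt_floor_add_one y
  have hj3 : 3 ≤ j := Nat.le_floor (by exact_mod_cast hy)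
  have hj3' : (3 : ℝ) ≤ j := by exact_mod_cast hj3
  have hjy3 : (j : ℝ) ^ 3 ≤ y ^ 3 := pow_le_pow_left₀ (by linarith) hjy 3
  have hmj : ((j ^ 2 : ℕ) : ℝ) * j ≤ 2 * r := by
    push_cast
    linarith [pow_succ (j : ℝ) 2]
  have hmr : j ^ 2 + 1 ≤ r := by
    have : ((j ^ 2 : ℕ) : ℝ) < r := by
      push_cast at hmj ⊢
      nlinarith [sq_nonneg (j : ℝ)]
    exact_mod_cast this
  have htail := exp_neg_le_zkTail hk hy3 hky (by linarith : (2 : ℝ) < j) hmj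
  have hexp : (j : ℝ) / (j - 2) * (((j ^ 2 : ℕ) : ℝ) ^ 2 / (2 * y ^ 3)) ≤ j / 2 + 3 := by
    have h1 : ((j ^ 2 : ℕ) : ℝ) ^ 2 / (2 * y ^ 3) ≤ j / 2 := by
      rw [div_le_div_iff₀ (by positivity) (by norm_num)]
      push_cast
      nlinarith
    have h2 : (0 : ℝ) < j - 2 := by linarith
    calc _ ≤ (j : ℝ) / (j - 2) * (j / 2) := mul_le_mul_of_nonneg_left h1 (by positivity)
      _ ≤ j / 2 + 3 := by
        rw [div_mul_eq_mul_div, div_le_iff₀ h2]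
        nlinarith
  have htail' : Real.exp (-(j / 2 + 3)) ≤ zkTail k r (j ^ 2) :=
    (Real.exp_le_exp.2 (neg_le_neg hexp)).trans htail
  have hsub := zkTail_div_le_sub hk hy3 hky (Nat.one_le_pow _ _ (by omega)) hmr
  have hpw : Real.exp (2 * j - 3) / j ^ 3 ≤ partitionWeight (j ^ 2) := by
    rw [div_le_iff₀' (by positivity)]
    exact exp_le_partitionWeight_sq j (by omega)
  have hmain : Real.exp (-(j / 2 + 3)) / y ^ 3 * (Real.exp (2 * j - 3) / j ^ 3) ≤
      zkExp (k * r) k (fun f => (Bmap f : ℝ)) := by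
    refine le_trans (mul_le_mul ((div_le_div_of_nonneg_right htail' hy3.le).trans hsub) hpw
      (by positivity) ?_) (mul_le_zkExp_Bmap (j ^ 2))
    refine le_trans ?_ hsub
    exact div_nonneg ((Real.exp_pos _).le.trans htail') hy3.le
  have hpos : 0 < Real.exp (-(j / 2 + 3)) / y ^ 3 * (Real.exp (2 * j - 3) / (j : ℝ) ^ 3) := by
    positivity
  refine ⟨hpos.trans_le hmain, le_trans ?_ (Real.log_le_log hpos hmain)⟩
  rw [Real.log_mul (by positivity) (by positivity), Real.log_div (by positivity) (by positivity),
    Real.log_div (by positivity) (by positivity), Real.log_exp, Real.log_exp, Real.log_pow,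
    Real.log_pow]
  have := Real.log_le_log (by linarith) hjy
  push_cast
  linarith

lemma abs_log_zkExp_Bmap_sub_le {k r : ℕ} {y : ℝ} (hk : 2 ≤ k) (hy : 3 ≤ y)
    (hky : y ^ 3 * (k - 1) = k * r) :
    |Real.log (zkExp (k * r) k (fun f => (Bmap f : ℝ))) - 3 / 2 * y| ≤ 8 + 6 * Real.log y := by
  obtain ⟨hpos, hlow⟩ := le_log_zkExp_Bmap hk hy hky
  have hup := log_zkExp_Bmap_le hk (by linarith) hky hpos
  have := Real.log_nonneg (by linarith : 1 ≤ y)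
  rw [abs_le]
  constructor <;> linarith

/-- `log E_n^{{0,k}}(B) = (3/2) (n/λ)^{1/3} (1 + o(1))`. -/
theorem stmt_10 (k n : ℕ → ℕ) (α : ℝ) (hα1 : 0 < α) (hα2 : α < 1)
    (hk : ∀ r, 2 ≤ k r) (hn : ∀ r, n r = k r * r)
    (hko : (fun r : ℕ => (k r : ℝ)) =o[atTop] (fun r : ℕ => (n r : ℝ) ^ (1 - α))) :
    ∃ e : ℕ → ℝ, Tendsto e atTop (nhds 0) ∧
      ∀ᶠ r : ℕ in atTop,
        Real.log (zkExp (n r) (k r) (fun f => (Bmap f : ℝ))) =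
          3 / 2 * ((n r : ℝ) / ((k r : ℝ) - 1)) ^ ((1 : ℝ) / 3) * (1 + e r) := by
  set y : ℕ → ℝ := fun r => ((n r : ℝ) / ((k r : ℝ) - 1)) ^ ((1 : ℝ) / 3) with hy
  have hk1 : ∀ r, (1 : ℝ) ≤ (k r : ℝ) - 1 := fun r => by
    have : (2 : ℝ) ≤ k r := by exact_mod_cast hk r
    linarith
  have hy3 : ∀ r, y r ^ 3 = (n r : ℝ) / ((k r : ℝ) - 1) := fun r => by
    have h0 : 0 ≤ (n r : ℝ) / ((k r : ℝ) - 1) :=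
      div_nonneg (Nat.cast_nonneg _) (by linarith [hk1 r])
    rw [hy, ← Real.rpow_natCast, ← Real.rpow_mul h0]
    norm_num
  have hky : ∀ r, y r ^ 3 * ((k r : ℝ) - 1) = k r * r := fun r => by
    rw [hy3, div_mul_cancel₀ _ (by linarith [hk1 r]), hn]
    push_cast
    rfl
  have hytop : Tendsto y atTop atTop := by
    refine tendsto_atTop_mono (f := fun r : ℕ => (r : ℝ) ^ ((1 : ℝ) / 3)) (fun r => ?_)
      ((tendsto_rpow_atTop (by norm_num)).comp tendsto_natCast_atTop_atTop)
    refine Real.rpow_le_rpow (Nat.cast_nonneg r) ?_ (by norm_num)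
    rw [le_div_iff₀ (by linarith [hk1 r]), hn]
    push_cast
    nlinarith [(Nat.cast_nonneg r : (0 : ℝ) ≤ r)]
  refine ⟨fun r => (Real.log (zkExp (n r) (k r) (fun f => (Bmap f : ℝ))) - 3 / 2 * y r) /
    (3 / 2 * y r), ?_, ?_⟩
  · have hlim : Tendsto (fun r => (8 / y r + 6 * (Real.log (y r) / y r)) / (3 / 2)) atTop
        (nhds 0) := by
      have h1 : Tendsto (fun t : ℝ => (8 / t + 6 * (Real.log t / t)) / (3 / 2)) atTop
          (nhds ((0 + 6 * 0) / (3 / 2))) :=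
        ((tendsto_const_nhds.div_atTop tendsto_id).add
          (Real.isLittleO_log_id_atTop.tendsto_div_nhds_zero.const_mul 6)).div_const _
      rw [mul_zero, add_zero, zero_div] at h1
      exact h1.comp hytop
    refine squeeze_zero_norm' ?_ hlim
    filter_upwards [hytop.eventually_ge_atTop 3] with r hr
    have hb := abs_log_zkExp_Bmap_sub_le (hk r) hr (hky r)
    have hypos : 0 < y r := by linarith
    rw [Real.norm_eq_abs, abs_div, abs_of_pos (by positivity : 0 < 3 / 2 * y r), hn,
      div_le_iff₀ (by positivity)]
    refine hb.trans (le_of_eq ?_)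
    field_simp
  · filter_upwards [hytop.eventually_ge_atTop 3] with r hr
    have hypos : 0 < y r := by linarith
    change _ = 3 / 2 * y r * _
    field_simp
    ring
end
end
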